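/- arXiv:1906.02617 — 3 statements merged into one kernel-verified Lean document; each statement's English description precedes it below -/
import Mathlib

section
/- There exists a constant C > 0 such that the following holds for every R ≥ 1. Let f : ℝ³ → ℝ be smooth and compactly supported. Write points of ℝ³ in polar coordinates adapted to the x-axis, p = (r cos θ, r sin θ cos φ, r sin θ sin φ) with r > 0, θ ∈ [0,π], φ ∈ [0,2π). Then for every point p with θ ∈ [π/8, 7π/8]: |f(p)|² ≤ C (R / r²) · Σ_{I, |I| ≤ 3} ‖V^I f‖²_{L²(ℝ³)}, where the sum runs over all lists I of at most 3 vector fields from the set A_R = { ∂_x, ∂_y, ∂_z, y∂_z − z∂_y, R^{−1}(x∂_y − y∂_x), R^{−1}(x∂_z − z∂_x), R^{−1}(x∂_x + y∂_y + z∂_z) }. -/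
open MeasureTheory

noncomputable section

/-- A spacetime point in `ℝ^{1+3}`; index `0` is the time coordinate. -/
abbrev Pt : Type := Fin 4 → ℝ

/-- A spatial point in `ℝ³`. -/
abbrev Sp : Type := Fin 3 → ℝ

/-- The inclusion of spatial indices into spacetime indices. -/
def sidx (i : Fin 3) : Fin 4 := i.succ

/-- Coordinate partial derivative `∂_i` on spacetime. -/
def pd (i : Fin 4) (f : Pt → ℝ) : Pt → ℝ := fun p => fderiv ℝ f p (Pi.single i 1)

/-- Derivative of `f` along the (spacetime) vector field `X`. -/
def vApp (X : Pt → Pt) (f : Pt → ℝ) : Pt → ℝ := fun p => fderiv ℝ f p (X p)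

/-- Successive application of a list of vector fields: `vIter [X₁, …, Xₘ] f = X₁ X₂ ⋯ Xₘ f`. -/
def vIter : List (Pt → Pt) → (Pt → ℝ) → Pt → ℝ
  | [], f => f
  | X :: L, f => vApp X (vIter L f)

/-- The Minkowski quadratic form on `ℝ^{1+3}`. -/
def mink (ξ : Pt) : ℝ := -(ξ 0) ^ 2 + (ξ 1) ^ 2 + (ξ 2) ^ 2 + (ξ 3) ^ 2

/-- The wave operator `□ = −∂_t² + Δ`. -/
def box (f : Pt → ℝ) : Pt → ℝ := fun p =>
  -pd 0 (pd 0 f) p + pd 1 (pd 1 f) p + pd 2 (pd 2 f) p + pd 3 (pd 3 f) p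

/-- A constant-coefficient trilinear classical null form. -/
def NullForm3 (F : Fin 4 → Fin 4 → Fin 4 → ℝ) : Prop :=
  ∀ ξ : Pt, mink ξ = 0 → (∑ a, ∑ b, ∑ c, F a b c * ξ a * ξ b * ξ c) = 0

/-- A constant-coefficient bilinear classical null form. -/
def NullForm2 (G : Fin 4 → Fin 4 → ℝ) : Prop :=
  ∀ ξ : Pt, mink ξ = 0 → (∑ a, ∑ b, G a b * ξ a * ξ b) = 0

/-- `F(dη, d²ζ) = F^{αβγ} ∂_αη ∂_β∂_γζ`. -/
def nf3 (F : Fin 4 → Fin 4 → Fin 4 → ℝ) (η ζ : Pt → ℝ) : Pt → ℝ := fun p =>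
  ∑ a, ∑ b, ∑ c, F a b c * pd a η p * pd b (pd c ζ) p

/-- `G(dη, dζ) = G^{αβ} ∂_αη ∂_βζ`. -/
def nf2 (G : Fin 4 → Fin 4 → ℝ) (η ζ : Pt → ℝ) : Pt → ℝ := fun p =>
  ∑ a, ∑ b, G a b * pd a η p * pd b ζ p

/-- Glue a time and a spatial point into a spacetime point. -/
def stp (t : ℝ) (x : Sp) : Pt := ![t, x 0, x 1, x 2]

/-- Euclidean length of a spatial point. -/
def rad3 (x : Sp) : ℝ := Real.sqrt ((x 0) ^ 2 + (x 1) ^ 2 + (x 2) ^ 2)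

/-- Euclidean distance between two spatial points. -/
def dist3 (x y : Sp) : ℝ := rad3 (x - y)

/-- Distance from the spatial part of the spacetime point `p` to the spatial center `q`. -/
def radq (q : Sp) (p : Pt) : ℝ :=
  Real.sqrt ((p 1 - q 0) ^ 2 + (p 2 - q 1) ^ 2 + (p 3 - q 2) ^ 2)

/-- `|∂f|` : the sum of the absolute values of the four coordinate derivatives. -/
def pdAbs (f : Pt → ℝ) (p : Pt) : ℝ :=
  |pd 0 f p| + |pd 1 f p| + |pd 2 f p| + |pd 3 f p|

/-- Sum of `|∂_a ∂_b f|` over all pairs of coordinate directions. -/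
def pd2Abs (f : Pt → ℝ) (p : Pt) : ℝ := ∑ a, ∑ b, |pd a (pd b f) p|

/-- Sum of `|∂_a ∂_b ∂_c f|` over all triples of coordinate directions. -/
def pd3Abs (f : Pt → ℝ) (p : Pt) : ℝ := ∑ a, ∑ b, ∑ c, |pd a (pd b (pd c f)) p|

/-- The null (outgoing) direction `∂_t + ∂_{r_q}` adapted to the spatial center `q`. -/
def nullVF (q : Sp) : Pt → Pt := fun p =>
  ![1, (p 1 - q 0) / radq q p, (p 2 - q 1) / radq q p, (p 3 - q 2) / radq q p]

/-- Rotation vector field about the center `q` in the spatial plane `(i,j)`. -/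
def rotVF (q : Sp) (i j : Fin 3) : Pt → Pt := fun p =>
  (p (sidx i) - q i) • (Pi.single (sidx j) 1 : Pt) -
    (p (sidx j) - q j) • (Pi.single (sidx i) 1 : Pt)

/-- `|∂̄^{(q)} f|` : sum of the absolute values of the good derivatives adapted to the
center `q`, namely `∂_t + ∂_{r_q}` and `(1+r_q)⁻¹` times each rotation about `q`. -/
def goodAbs (q : Sp) (f : Pt → ℝ) (p : Pt) : ℝ :=
  |vApp (nullVF q) f p|
    + (1 + radq q p)⁻¹ * |vApp (rotVF q 0 1) f p|
    + (1 + radq q p)⁻¹ * |vApp (rotVF q 0 2) f p|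
    + (1 + radq q p)⁻¹ * |vApp (rotVF q 1 2) f p|

/-- Translation vector field `∂_a`. -/
def transVF (a : Fin 4) : Pt → Pt := fun _ => Pi.single a 1

/-- Lorentz boost `t∂_{x_i} + (x_i − q_i)∂_t` centered at `q`. -/
def boostVF (q : Sp) (i : Fin 3) : Pt → Pt := fun p =>
  (p 0) • (Pi.single (sidx i) 1 : Pt) + (p (sidx i) - q i) • (Pi.single 0 1 : Pt)

/-- Scaling vector field `t∂_t + (x−q)·∇` centered at `q`. -/
def scaleVF (q : Sp) : Pt → Pt := fun p => ![p 0, p 1 - q 0, p 2 - q 1, p 3 - q 2]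

/-- Rescaling of a vector field by a constant. -/
def smulVF (c : ℝ) (X : Pt → Pt) : Pt → Pt := fun p => c • X p

/-- The spatial origin. -/
def o3 : Sp := ![0, 0, 0]

/-- The point `(a,0,0)` on the x-axis. -/
def axisPt (a : ℝ) : Sp := ![a, 0, 0]

/-- The eleven fields of `K` centered at `q`: translations, rotations, boosts and scaling. -/
def Kfields (q : Sp) : List (Pt → Pt) :=
  [transVF 0, transVF 1, transVF 2, transVF 3,
   rotVF q 0 1, rotVF q 0 2, rotVF q 1 2,
   boostVF q 0, boostVF q 1, boostVF q 2, scaleVF q]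

/-- `K_R` centered at `q`: the translations together with `R⁻¹` times the rotations,
boosts and scaling. -/
def KRfields (R : ℝ) (q : Sp) : List (Pt → Pt) :=
  [transVF 0, transVF 1, transVF 2, transVF 3] ++
    ([rotVF q 0 1, rotVF q 0 2, rotVF q 1 2,
      boostVF q 0, boostVF q 1, boostVF q 2, scaleVF q].map (smulVF R⁻¹))

/-- `Γ^{(a)}`: the good fields `Γ̄` (the rotation and boosts not involving `x`), the
translations, and `R⁻¹` times the rotations, boosts and scaling centered at `(a,0,0)`. -/
def GammaFields (R a : ℝ) : List (Pt → Pt) :=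
  [rotVF (axisPt a) 1 2, boostVF (axisPt a) 1, boostVF (axisPt a) 2,
   transVF 0, transVF 1, transVF 2, transVF 3] ++
    ([rotVF (axisPt a) 0 1, rotVF (axisPt a) 0 2, rotVF (axisPt a) 1 2,
      boostVF (axisPt a) 0, boostVF (axisPt a) 1, boostVF (axisPt a) 2,
      scaleVF (axisPt a)].map (smulVF R⁻¹))

/-- Spatial coordinate partial derivative. -/
def spd (i : Fin 3) (g : Sp → ℝ) : Sp → ℝ := fun x => fderiv ℝ g x (Pi.single i 1)

/-- Iterated spatial derivative along a list of coordinate directions. -/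
def spdIter : List (Fin 3) → (Sp → ℝ) → Sp → ℝ
  | [], g => g
  | i :: L, g => spd i (spdIter L g)

/-- `|∂̂^k g|` : the sum of the absolute values of all `k`-fold iterated spatial
coordinate partial derivatives of `g`. -/
def hatD (k : ℕ) (g : Sp → ℝ) (x : Sp) : ℝ :=
  ∑ I : Fin k → Fin 3, |spdIter (List.ofFn I) g x|

/-- The `L²(Σ_t)` norm of `f` on the time slice `Σ_t`. -/
def slice2 (f : Pt → ℝ) (t : ℝ) : ℝ := Real.sqrt (∫ x : Sp, (f (stp t x)) ^ 2)

/-- The `H^k(ℝ³)` Sobolev norm (square root of the sum of the squared `L²` norms of all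
iterated spatial derivatives of order at most `k`). -/
def sobNorm (k : ℕ) (g : Sp → ℝ) : ℝ :=
  Real.sqrt (∑ j ∈ Finset.range (k + 1), ∑ I : Fin j → Fin 3,
    ∫ x : Sp, (spdIter (List.ofFn I) g x) ^ 2)

/-- Derivative of `g : ℝ³ → ℝ` along a spatial vector field. -/
def svApp (X : Sp → Sp) (g : Sp → ℝ) : Sp → ℝ := fun x => fderiv ℝ g x (X x)

/-- Successive application of a list of spatial vector fields. -/
def svIter : List (Sp → Sp) → (Sp → ℝ) → Sp → ℝ
  | [], g => g
  | X :: L, g => svApp X (svIter L g)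

/-- The point of the unit sphere with spherical angles `(θ, φ)` (measured from the x-axis). -/
def sphPt (θ φ : ℝ) : Sp :=
  ![Real.cos θ, Real.sin θ * Real.cos φ, Real.sin θ * Real.sin φ]

/-- The point of the hyperboloid `H_τ` with parameters `(α, x, φ)`. -/
def hpt (τ α x φ : ℝ) : Pt :=
  ![τ * Real.cosh α, x, τ * Real.sinh α * Real.cos φ, τ * Real.sinh α * Real.sin φ]


/-- The seven spatial vector fields
`∂_x, ∂_y, ∂_z, y∂_z − z∂_y, R⁻¹(x∂_y − y∂_x), R⁻¹(x∂_z − z∂_x), R⁻¹(x∂_x + y∂_y + z∂_z)`. -/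
def Afields (R : ℝ) : List (Sp → Sp) :=
  [fun _ => (Pi.single 0 1 : Sp), fun _ => (Pi.single 1 1 : Sp), fun _ => (Pi.single 2 1 : Sp),
   fun x => x 1 • (Pi.single 2 1 : Sp) - x 2 • (Pi.single 1 1 : Sp),
   fun x => R⁻¹ • (x 0 • (Pi.single 1 1 : Sp) - x 1 • (Pi.single 0 1 : Sp)),
   fun x => R⁻¹ • (x 0 • (Pi.single 2 1 : Sp) - x 2 • (Pi.single 0 1 : Sp)),
   fun x => R⁻¹ • x]

/-- One-dimensional Sobolev inequality on the unit interval, at its left endpoint. -/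
lemma ofReal_sq_zero_le_lintegral {h : ℝ → ℝ} (hh : ContDiff ℝ 1 h) {K : ℝ → ENNReal}
    (hK : ∀ t, ENNReal.ofReal (2 * h t ^ 2 + deriv h t ^ 2) ≤ K t) :
    ENNReal.ofReal (h 0 ^ 2) ≤ ∫⁻ t, K t ∂(volume.restrict (Set.Ioc (0 : ℝ) 1)) := by
  have hd : ∀ t, HasDerivAt h (deriv h t) t := fun t =>
    (hh.differentiable one_ne_zero t).hasDerivAt
  have hc : Continuous h := hh.continuous
  have hc' : Continuous (deriv h) := hh.continuous_deriv le_rfl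
  have hF : ∀ t, HasDerivAt (fun t => (1 - t) * h t ^ 2)
      (-h t ^ 2 + (1 - t) * (2 * h t * deriv h t)) t := by
    intro t
    have h1 := ((hasDerivAt_id t).const_sub 1).mul ((hd t).pow 2)
    convert! h1 using 1
    simp
  have hint : ∫ t in (0 : ℝ)..1, (-h t ^ 2 + (1 - t) * (2 * h t * deriv h t)) = - h 0 ^ 2 := by
    rw [intervalIntegral.integral_eq_sub_of_hasDerivAt (fun t _ => hF t)
      ((by fun_prop : Continuous _).intervalIntegrable _ _)]
    simp
  have hle : h 0 ^ 2 ≤ ∫ t in (0 : ℝ)..1, (2 * h t ^ 2 + deriv h t ^ 2) := by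
    have h2 : h 0 ^ 2 = ∫ t in (0 : ℝ)..1, -(-h t ^ 2 + (1 - t) * (2 * h t * deriv h t)) := by
      rw [intervalIntegral.integral_neg, hint, neg_neg]
    rw [h2]
    refine intervalIntegral.integral_mono_on zero_le_one
      ((by fun_prop : Continuous _).intervalIntegrable _ _)
      ((by fun_prop : Continuous _).intervalIntegrable _ _) fun t ht => ?_
    nlinarith [sq_nonneg ((1 - t) * h t + deriv h t),
      mul_nonneg (mul_nonneg ht.1 (by linarith [ht.2] : (0 : ℝ) ≤ 2 - t)) (sq_nonneg (h t))]
  calc ENNReal.ofReal (h 0 ^ 2)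
      ≤ ENNReal.ofReal (∫ t in (0 : ℝ)..1, (2 * h t ^ 2 + deriv h t ^ 2)) :=
        ENNReal.ofReal_le_ofReal hle
    _ = ∫⁻ t in Set.Ioc (0 : ℝ) 1, ENNReal.ofReal (2 * h t ^ 2 + deriv h t ^ 2) := by
        rw [intervalIntegral.integral_of_le zero_le_one]
        refine ofReal_integral_eq_lintegral_ofReal ?_ (.of_forall fun t => by positivity)
        have : Continuous fun t => 2 * h t ^ 2 + deriv h t ^ 2 := by fun_prop
        exact (this.integrableOn_Icc).mono_set Set.Ioc_subset_Icc_self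
    _ ≤ _ := lintegral_mono hK

lemma contDiff_svIter {f : Sp → ℝ} (hf : ContDiff ℝ (⊤ : ℕ∞) f) {L : List (Sp → Sp)}
    (hL : ∀ X ∈ L, ContDiff ℝ (⊤ : ℕ∞) X) : ContDiff ℝ (⊤ : ℕ∞) (svIter L f) := by
  induction L with
  | nil => exact hf
  | cons X L ih =>
    have h := ih fun Y hY => hL Y (List.mem_cons_of_mem _ hY)
    exact (h.fderiv_right (by simp)).clm_apply (hL X List.mem_cons_self)

lemma hasCompactSupport_svIter {f : Sp → ℝ} (hf : HasCompactSupport f) (L : List (Sp → Sp)) :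
    HasCompactSupport (svIter L f) := by
  induction L with
  | nil => exact hf
  | cons X L ih =>
    refine (ih.fderiv (𝕜 := ℝ)).mono fun x hx hx' => hx ?_
    simp [svIter, svApp, hx']

lemma contDiff_Afields {R : ℝ} {X : Sp → Sp} (hX : X ∈ Afields R) :
    ContDiff ℝ (⊤ : ℕ∞) X := by
  simp only [Afields, List.mem_cons, List.not_mem_nil, or_false] at hX
  rcases hX with rfl | rfl | rfl | rfl | rfl | rfl | rfl <;> fun_prop

/-- The sum of the squares of all words of length at most three in the fields of `A_R`. -/
def wordSq (R : ℝ) (f : Sp → ℝ) (x : Sp) : ℝ :=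
  ∑ k ∈ Finset.range 4, ∑ I : Fin k → Fin (Afields R).length,
    (svIter ((List.ofFn I).map (Afields R).get) f x) ^ 2

lemma contDiff_word {R : ℝ} {f : Sp → ℝ} (hf : ContDiff ℝ (⊤ : ℕ∞) f)
    (l : List (Fin (Afields R).length)) :
    ContDiff ℝ (⊤ : ℕ∞) (svIter (l.map (Afields R).get) f) := by
  refine contDiff_svIter hf fun X hX => ?_
  obtain ⟨i, -, rfl⟩ := List.mem_map.1 hX
  exact contDiff_Afields (List.get_mem _ _)

lemma sq_word_le_wordSq (R : ℝ) (f : Sp → ℝ) {l : List (Fin (Afields R).length)}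
    (hl : l.length ≤ 3) (x : Sp) :
    svIter (l.map (Afields R).get) f x ^ 2 ≤ wordSq R f x := by
  have h1 := Finset.single_le_sum
    (f := fun I : Fin l.length → Fin (Afields R).length =>
      (svIter ((List.ofFn I).map (Afields R).get) f x) ^ 2)
    (fun _ _ => sq_nonneg _) (Finset.mem_univ l.get)
  have h2 := Finset.single_le_sum
    (f := fun k => ∑ I : Fin k → Fin (Afields R).length,
      (svIter ((List.ofFn I).map (Afields R).get) f x) ^ 2)
    (fun _ _ => Finset.sum_nonneg fun _ _ => sq_nonneg _)
    (Finset.mem_range.2 (Nat.lt_succ_of_le hl))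
  rw [List.ofFn_get] at h1
  exact h1.trans h2

lemma wordSq_nonneg (R : ℝ) (f : Sp → ℝ) (x : Sp) : 0 ≤ wordSq R f x :=
  Finset.sum_nonneg fun _ _ => Finset.sum_nonneg fun _ _ => sq_nonneg _

lemma continuous_wordSq {R : ℝ} {f : Sp → ℝ} (hf : ContDiff ℝ (⊤ : ℕ∞) f) :
    Continuous (wordSq R f) :=
  continuous_finsetSum _ fun _ _ => continuous_finsetSum _ fun I _ =>
    (contDiff_word hf (List.ofFn I)).continuous.pow 2

lemma integrable_sq_word {R : ℝ} {f : Sp → ℝ} (hf : ContDiff ℝ (⊤ : ℕ∞) f)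
    (hfc : HasCompactSupport f) (l : List (Fin (Afields R).length)) :
    Integrable fun x => svIter (l.map (Afields R).get) f x ^ 2 := by
  refine ((contDiff_word hf l).continuous.pow 2).integrable_of_hasCompactSupport ?_
  refine (hasCompactSupport_svIter hfc (l.map (Afields R).get)).mono fun x hx hx' => hx ?_
  simp [hx']

lemma lintegral_wordSq {R : ℝ} {f : Sp → ℝ} (hf : ContDiff ℝ (⊤ : ℕ∞) f)
    (hfc : HasCompactSupport f) :
    ∫⁻ x, ENNReal.ofReal (wordSq R f x) =
      ENNReal.ofReal (∑ k ∈ Finset.range 4, ∑ I : Fin k → Fin (Afields R).length,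
        ∫ x : Sp, (svIter ((List.ofFn I).map (Afields R).get) f x) ^ 2) := by
  have hi : ∀ (k : ℕ) (I : Fin k → Fin (Afields R).length), Integrable fun x =>
      svIter ((List.ofFn I).map (Afields R).get) f x ^ 2 := fun k I =>
    integrable_sq_word hf hfc (List.ofFn I)
  rw [← ofReal_integral_eq_lintegral_ofReal (f := wordSq R f)
    (integrable_finsetSum _ fun k _ => integrable_finsetSum _ fun I _ => hi k I)
    (.of_forall (wordSq_nonneg R f))]
  unfold wordSq
  rw [integral_finsetSum _ fun k _ => integrable_finsetSum _ fun I _ => hi k I]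
  simp_rw [integral_finsetSum _ fun I _ => hi _ I]

/-- Sobolev inequality on the part of the unit cube in the directions `s`, in coordinates `Ψ`
whose coordinate fields are bounded combinations of fields of `A_R`. -/
lemma ofReal_sq_word_le_lmarginal {R : ℝ} {f : Sp → ℝ} (hf : ContDiff ℝ (⊤ : ℕ∞) f)
    {Ψ : Sp → Sp} (hΨ : ContDiff ℝ (⊤ : ℕ∞) Ψ)
    (hcol : ∀ m, ∃ i j, ∀ v, ∃ a b : ℝ, a ^ 2 ≤ 1 ∧ b ^ 2 ≤ 1 ∧
      fderiv ℝ Ψ v (Pi.single m 1) =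
        a • (Afields R).get i (Ψ v) + b • (Afields R).get j (Ψ v))
    (s : Finset (Fin 3)) (l : List (Fin (Afields R).length)) (hl : l.length + s.card ≤ 3)
    (v : Sp) (hv : ∀ m ∈ s, v m = 0) :
    ENNReal.ofReal (svIter (l.map (Afields R).get) f (Ψ v) ^ 2) ≤
      6 ^ s.card * lmarginal (fun _ => volume.restrict (Set.Ioc (0 : ℝ) 1)) s
        (fun w => ENNReal.ofReal (wordSq R f (Ψ w))) v := by
  have hmeas : Measurable fun w => ENNReal.ofReal (wordSq R f (Ψ w)) :=
    ((continuous_wordSq hf).comp hΨ.continuous).measurable.ennreal_ofReal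
  induction s using Finset.induction_on generalizing l v with
  | empty =>
    simp only [Finset.card_empty, pow_zero, lmarginal_empty, one_mul]
    exact ENNReal.ofReal_le_ofReal (sq_word_le_wordSq R f (by simpa using hl) _)
  | insert m s hm ih =>
    rw [Finset.card_insert_of_notMem hm] at hl ⊢
    rw [lmarginal_insert _ hmeas hm, pow_succ (6 : ENNReal), mul_assoc, ← lintegral_const_mul' _ _ (by simp),
      ← lintegral_const_mul' _ _ (by simp)]
    obtain ⟨i, j, hij⟩ := hcol m
    set g := svIter (l.map (Afields R).get) f with hg
    have hgs : ContDiff ℝ (⊤ : ℕ∞) g := contDiff_word hf l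
    have hcurve : ∀ t, HasDerivAt (fun t => g (Ψ (Function.update v m t)))
        (fderiv ℝ g (Ψ (Function.update v m t))
          (fderiv ℝ Ψ (Function.update v m t) (Pi.single m 1))) t := fun t =>
      ((hgs.differentiable (by simp) _).hasFDerivAt).comp_hasDerivAt t
        (((hΨ.differentiable (by simp) _).hasFDerivAt).comp_hasDerivAt t
          (hasDerivAt_update v m t))
    have h0 : Function.update v m 0 = v := by
      rw [← hv m (Finset.mem_insert_self m s), Function.update_eq_self]
    have hsm : ContDiff ℝ 1 fun t => g (Ψ (Function.update v m t)) :=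
      ((hgs.comp hΨ).of_le (by exact_mod_cast le_top)).comp (contDiff_update 1 v m)
    have key := ofReal_sq_zero_le_lintegral hsm (K := fun t => 6 ^ s.card * (6 *
      lmarginal (fun _ => volume.restrict (Set.Ioc (0 : ℝ) 1)) s
        (fun w => ENNReal.ofReal (wordSq R f (Ψ w))) (Function.update v m t))) ?_
    · simpa only [h0] using key
    intro t
    set w := Function.update v m t with hw
    have hwz : ∀ n ∈ s, w n = 0 := fun n hn => by
      rw [hw, Function.update_of_ne (ne_of_mem_of_not_mem hn hm), hv n (Finset.mem_insert_of_mem hn)]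
    have e0 := ih l (by omega) w hwz
    have e1 := ih (i :: l) (by simp; omega) w hwz
    have e2 := ih (j :: l) (by simp; omega) w hwz
    obtain ⟨a, b, ha, hb, hab⟩ := hij w
    rw [(hcurve t).deriv, ← hw, hab, map_add, map_smul, map_smul]
    set T := lmarginal (fun _ => volume.restrict (Set.Ioc (0 : ℝ) 1)) s
        (fun w => ENNReal.ofReal (wordSq R f (Ψ w))) w
    simp only [List.map_cons, svIter, svApp, ← hg] at e1 e2
    set p := g (Ψ w)
    set q := fderiv ℝ g (Ψ w) ((Afields R).get i (Ψ w))
    set r := fderiv ℝ g (Ψ w) ((Afields R).get j (Ψ w))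
    have hle : 2 * p ^ 2 + (a • q + b • r) ^ 2 ≤ 2 * (p ^ 2 + q ^ 2 + r ^ 2) := by
      simp only [smul_eq_mul]
      nlinarith [sq_nonneg (a * q - b * r), mul_le_mul_of_nonneg_right ha (sq_nonneg q),
        mul_le_mul_of_nonneg_right hb (sq_nonneg r)]
    calc ENNReal.ofReal (2 * p ^ 2 + (a • q + b • r) ^ 2)
        ≤ ENNReal.ofReal (2 * (p ^ 2 + q ^ 2 + r ^ 2)) := ENNReal.ofReal_le_ofReal hle
      _ = 2 * (ENNReal.ofReal (p ^ 2) + ENNReal.ofReal (q ^ 2) + ENNReal.ofReal (r ^ 2)) := by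
        rw [ENNReal.ofReal_mul zero_le_two, ENNReal.ofReal_add (by positivity) (by positivity),
          ENNReal.ofReal_add (by positivity) (by positivity)]
        simp
      _ ≤ 2 * (6 ^ s.card * T + 6 ^ s.card * T + 6 ^ s.card * T) := by gcongr
      _ = 6 ^ s.card * (6 * T) := by ring

/-- Sobolev inequality at the vertex of a curvilinear cube `Ψ ((0,1]³)` of Jacobian at least `J`
whose coordinate fields are bounded combinations of fields of `A_R`. -/
lemma sq_le_of_coordinates {R J : ℝ} (hJ : 0 < J) {f : Sp → ℝ} (hf : ContDiff ℝ (⊤ : ℕ∞) f)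
    (hfc : HasCompactSupport f) {Ψ : Sp → Sp} (hΨ : ContDiff ℝ (⊤ : ℕ∞) Ψ)
    {M : Sp → Matrix (Fin 3) (Fin 3) ℝ}
    (hM : ∀ v, HasFDerivAt Ψ (Matrix.toLin' (M v)).toContinuousLinearMap v)
    (hcol : ∀ m, ∃ i j, ∀ v, ∃ a b : ℝ, a ^ 2 ≤ 1 ∧ b ^ 2 ≤ 1 ∧
      (M v).col m = a • (Afields R).get i (Ψ v) + b • (Afields R).get j (Ψ v))
    (hinj : Set.InjOn Ψ (Set.univ.pi fun _ => Set.Ioc 0 1))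
    (hdet : ∀ v ∈ Set.univ.pi (fun _ : Fin 3 => Set.Ioc (0 : ℝ) 1), J ≤ |(M v).det|) :
    f (Ψ 0) ^ 2 ≤ 216 / J * ∑ k ∈ Finset.range 4, ∑ I : Fin k → Fin (Afields R).length,
      ∫ x : Sp, (svIter ((List.ofFn I).map (Afields R).get) f x) ^ 2 := by
  have hQ : MeasurableSet (Set.univ.pi fun _ : Fin 3 => Set.Ioc (0 : ℝ) 1) :=
    MeasurableSet.univ_pi fun _ => measurableSet_Ioc
  have h1 := ofReal_sq_word_le_lmarginal (R := R) hf hΨ (fun m => by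
    obtain ⟨i, j, h⟩ := hcol m
    refine ⟨i, j, fun v => ?_⟩
    obtain ⟨a, b, ha, hb, hab⟩ := h v
    refine ⟨a, b, ha, hb, ?_⟩
    rw [(hM v).fderiv, ← hab]
    simp) Finset.univ [] (by simp) 0 (fun _ _ => rfl)
  rw [← lintegral_eq_lmarginal_univ, ← Measure.restrict_pi_pi, ← volume_pi] at h1
  have h2 : ENNReal.ofReal J * ∫⁻ v in Set.univ.pi fun _ : Fin 3 => Set.Ioc (0 : ℝ) 1,
      ENNReal.ofReal (wordSq R f (Ψ v)) ≤ ∫⁻ x, ENNReal.ofReal (wordSq R f x) := by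
    rw [← lintegral_const_mul' _ _ (by simp)]
    calc _ ≤ ∫⁻ v in Set.univ.pi fun _ : Fin 3 => Set.Ioc (0 : ℝ) 1,
          ENNReal.ofReal |((Matrix.toLin' (M v)).toContinuousLinearMap).det| *
            ENNReal.ofReal (wordSq R f (Ψ v)) := by
          refine setLIntegral_mono' hQ fun v hv => ?_
          gcongr
          simpa [ContinuousLinearMap.det] using hdet v hv
      _ = ∫⁻ x in Ψ '' (Set.univ.pi fun _ : Fin 3 => Set.Ioc (0 : ℝ) 1),
          ENNReal.ofReal (wordSq R f x) :=
          (lintegral_image_eq_lintegral_abs_det_fderiv_mul volume hQ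
            (fun v _ => (hM v).hasFDerivWithinAt) hinj
            fun x => ENNReal.ofReal (wordSq R f x)).symm
      _ ≤ _ := setLIntegral_le_lintegral _ _
  rw [lintegral_wordSq hf hfc] at h2
  set S := ∑ k ∈ Finset.range 4, ∑ I : Fin k → Fin (Afields R).length,
      ∫ x : Sp, (svIter ((List.ofFn I).map (Afields R).get) f x) ^ 2
  have hS : 0 ≤ S := Finset.sum_nonneg fun _ _ => Finset.sum_nonneg fun _ _ =>
    integral_nonneg fun _ => sq_nonneg _
  have h3 : ENNReal.ofReal (J * f (Ψ 0) ^ 2) ≤ ENNReal.ofReal (216 * S) := by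
    rw [ENNReal.ofReal_mul hJ.le, ENNReal.ofReal_mul (by norm_num)]
    calc _ ≤ ENNReal.ofReal J * _ := mul_le_mul_right h1 _
      _ = 6 ^ 3 * _ := mul_left_comm _ _ _
      _ ≤ 6 ^ 3 * ENNReal.ofReal S := mul_le_mul_right h2 _
      _ = _ := by norm_num
  rw [ENNReal.ofReal_le_ofReal_iff (by positivity)] at h3
  rw [div_mul_eq_mul_div, le_div_iff₀ hJ]
  linarith

lemma sin_pi_div_eight_le {θ : ℝ} (h₁ : Real.pi / 8 ≤ θ) (h₂ : θ ≤ 7 * Real.pi / 8) :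
    Real.sin (Real.pi / 8) ≤ Real.sin θ := by
  have hpi := Real.pi_pos
  rcases le_total θ (Real.pi / 2) with h | h
  · exact Real.sin_le_sin_of_le_of_le_pi_div_two (by linarith) h h₁
  · rw [← Real.sin_pi_sub θ]
    exact Real.sin_le_sin_of_le_of_le_pi_div_two (by linarith) (by linarith) (by linarith)

lemma polar_injOn {a b φ s t : ℝ} (ha : 0 < a) (hb : 0 < b) (hs : s ∈ Set.Ioc (0 : ℝ) 1)
    (ht : t ∈ Set.Ioc (0 : ℝ) 1) (h₁ : a * Real.cos (φ + s) = b * Real.cos (φ + t))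
    (h₂ : a * Real.sin (φ + s) = b * Real.sin (φ + t)) : a = b ∧ s = t := by
  have hab : a = b := by
    have h : a ^ 2 = b ^ 2 := by
      calc a ^ 2 = (a * Real.cos (φ + s)) ^ 2 + (a * Real.sin (φ + s)) ^ 2 := by
            linear_combination (-a ^ 2) * Real.sin_sq_add_cos_sq (φ + s)
        _ = b ^ 2 := by
            rw [h₁, h₂]
            linear_combination (b ^ 2) * Real.sin_sq_add_cos_sq (φ + t)
    exact (sq_eq_sq₀ ha.le hb.le).1 h
  subst hab
  refine ⟨rfl, ?_⟩
  have hc := mul_left_cancel₀ ha.ne' h₁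
  have hs' := mul_left_cancel₀ ha.ne' h₂
  have : Real.cos (s - t) = 1 := by
    rw [show s - t = (φ + s) - (φ + t) by ring, Real.cos_sub, hc, hs']
    linear_combination Real.sin_sq_add_cos_sq (φ + t)
  have hpi := Real.pi_gt_three
  rw [Real.cos_eq_one_iff_of_lt_of_lt (by linarith [hs.1, ht.2]) (by linarith [hs.2, ht.1])] at this
  linarith

/-- Sobolev inequality in cylindrical coordinates about the `x`-axis. -/
lemma sq_le_of_cylindrical (R x₀ ρ φ : ℝ) (hρ : 0 < ρ) {f : Sp → ℝ}
    (hf : ContDiff ℝ (⊤ : ℕ∞) f) (hfc : HasCompactSupport f) :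
    f ![x₀, ρ * Real.cos φ, ρ * Real.sin φ] ^ 2 ≤
      216 / ρ * ∑ k ∈ Finset.range 4, ∑ I : Fin k → Fin (Afields R).length,
      ∫ x : Sp, (svIter ((List.ofFn I).map (Afields R).get) f x) ^ 2 := by
  let Ψ : Sp → Sp := fun v => ![x₀ + v 0, (ρ + v 1) * Real.cos (φ + v 2),
    (ρ + v 1) * Real.sin (φ + v 2)]
  let M : Sp → Matrix (Fin 3) (Fin 3) ℝ := fun v =>
    !![1, 0, 0;
       0, Real.cos (φ + v 2), -((ρ + v 1) * Real.sin (φ + v 2));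
       0, Real.sin (φ + v 2), (ρ + v 1) * Real.cos (φ + v 2)]
  have hΨ : ContDiff ℝ (⊤ : ℕ∞) Ψ := by
    rw [contDiff_pi]
    intro i
    fin_cases i <;> simp [Ψ] <;> fun_prop
  have hM : ∀ v, HasFDerivAt Ψ (Matrix.toLin' (M v)).toContinuousLinearMap v := by
    intro v
    have p := fun i : Fin 3 => hasFDerivAt_apply (𝕜 := ℝ) (F' := fun _ : Fin 3 => ℝ) i v
    rw [hasFDerivAt_pi']
    intro i
    fin_cases i
    · refine ((p 0).const_add x₀).congr_fderiv ?_
      ext w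
      simp [M, dotProduct, Fin.sum_univ_three]
    · refine (((p 1).const_add ρ).mul (((p 2).const_add φ).cos)).congr_fderiv ?_
      ext w
      simp [M, dotProduct, Fin.sum_univ_three]
      ring
    · refine (((p 1).const_add ρ).mul (((p 2).const_add φ).sin)).congr_fderiv ?_
      ext w
      simp [M, dotProduct, Fin.sum_univ_three]
      ring
  have hcol : ∀ m, ∃ i j, ∀ v, ∃ a b : ℝ, a ^ 2 ≤ 1 ∧ b ^ 2 ≤ 1 ∧
      (M v).col m = a • (Afields R).get i (Ψ v) + b • (Afields R).get j (Ψ v) := by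
    intro m
    fin_cases m
    · refine ⟨⟨0, by simp [Afields]⟩, ⟨0, by simp [Afields]⟩, fun v =>
        ⟨1, 0, by simp, by simp, ?_⟩⟩
      ext k
      fin_cases k <;> simp [M, Afields]
    · refine ⟨⟨1, by simp [Afields]⟩, ⟨2, by simp [Afields]⟩, fun v =>
        ⟨Real.cos (φ + v 2), Real.sin (φ + v 2), Real.cos_sq_le_one _, Real.sin_sq_le_one _, ?_⟩⟩
      ext k
      fin_cases k <;> simp [M, Afields]
    · refine ⟨⟨3, by simp [Afields]⟩, ⟨3, by simp [Afields]⟩, fun v =>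
        ⟨1, 0, by simp, by simp, ?_⟩⟩
      ext k
      fin_cases k <;> simp [M, Ψ, Afields]
  have hinj : Set.InjOn Ψ (Set.univ.pi fun _ => Set.Ioc 0 1) := by
    intro v hv w hw h
    simp only [Set.mem_univ_pi] at hv hw
    have e0 := congrFun h 0
    have e1 := congrFun h 1
    have e2 := congrFun h 2
    simp [Ψ] at e0 e1 e2
    obtain ⟨h1, h2⟩ := polar_injOn (by linarith [(hv 1).1]) (by linarith [(hw 1).1])
      (hv 2) (hw 2) e1 e2
    ext k
    fin_cases k
    · exact e0
    · exact add_left_cancel h1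
    · exact h2
  have hdet : ∀ v ∈ Set.univ.pi (fun _ : Fin 3 => Set.Ioc (0 : ℝ) 1), ρ ≤ |(M v).det| := by
    intro v hv
    have hd : (M v).det = ρ + v 1 := by
      simp [M, Matrix.det_fin_three]
      linear_combination (ρ + v 1) * Real.sin_sq_add_cos_sq (φ + v 2)
    have := (hv 1 trivial).1
    rw [hd]
    exact le_trans (by linarith) (le_abs_self _)
  have := sq_le_of_coordinates (R := R) hρ hf hfc hΨ hM hcol hinj hdet
  simpa [Ψ] using this

/-- Sobolev inequality in logarithmic spherical coordinates about the `x`-axis, for an angular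
interval of length `R⁻¹` on which `sin` is at least `c`. -/
lemma sq_le_of_spherical {R r c σ θ : ℝ} (φ : ℝ) (hR : 0 < R) (hr : 0 < r) (hc : 0 < c)
    (hσ : σ ^ 2 = 1)
    (hθ : ∀ t ∈ Set.Ioc (0 : ℝ) 1, θ + σ * (R⁻¹ * t) ∈ Set.Icc 0 Real.pi ∧
      c ≤ Real.sin (θ + σ * (R⁻¹ * t)))
    {f : Sp → ℝ} (hf : ContDiff ℝ (⊤ : ℕ∞) f) (hfc : HasCompactSupport f) :
    f (r • sphPt θ φ) ^ 2 ≤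
      216 / (r ^ 3 * c * R⁻¹ ^ 2) *
      ∑ k ∈ Finset.range 4, ∑ I : Fin k → Fin (Afields R).length,
      ∫ x : Sp, (svIter ((List.ofFn I).map (Afields R).get) f x) ^ 2 := by
  let ρ : Sp → ℝ := fun v => r * Real.exp (R⁻¹ * v 0)
  let τ : Sp → ℝ := fun v => θ + σ * (R⁻¹ * v 1)
  let ψ : Sp → ℝ := fun v => φ + v 2
  let Ψ : Sp → Sp := fun v => ![ρ v * Real.cos (τ v), ρ v * Real.sin (τ v) * Real.cos (ψ v),
    ρ v * Real.sin (τ v) * Real.sin (ψ v)]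
  let M : Sp → Matrix (Fin 3) (Fin 3) ℝ := fun v =>
    !![R⁻¹ * (ρ v * Real.cos (τ v)), -(σ * R⁻¹ * (ρ v * Real.sin (τ v))), 0;
       R⁻¹ * (ρ v * Real.sin (τ v) * Real.cos (ψ v)),
         σ * R⁻¹ * (ρ v * Real.cos (τ v) * Real.cos (ψ v)),
         -(ρ v * Real.sin (τ v) * Real.sin (ψ v));
       R⁻¹ * (ρ v * Real.sin (τ v) * Real.sin (ψ v)),
         σ * R⁻¹ * (ρ v * Real.cos (τ v) * Real.sin (ψ v)),
         ρ v * Real.sin (τ v) * Real.cos (ψ v)]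
  have hρ : ∀ v, 0 < ρ v := fun v => by positivity
  have hΨ : ContDiff ℝ (⊤ : ℕ∞) Ψ := by
    rw [contDiff_pi]
    intro i
    fin_cases i <;> simp [Ψ, ρ, τ, ψ] <;> fun_prop
  have hM : ∀ v, HasFDerivAt Ψ (Matrix.toLin' (M v)).toContinuousLinearMap v := by
    intro v
    have p := fun i : Fin 3 => hasFDerivAt_apply (𝕜 := ℝ) (F' := fun _ : Fin 3 => ℝ) i v
    have dρ := (((p 0).const_mul R⁻¹).exp).const_mul r
    have dτ := (((p 1).const_mul R⁻¹).const_mul σ).const_add θ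
    have dψ := (p 2).const_add φ
    rw [hasFDerivAt_pi']
    intro i
    fin_cases i
    · refine (dρ.mul dτ.cos).congr_fderiv ?_
      ext w
      simp [M, ρ, τ, dotProduct, Fin.sum_univ_three]
      ring
    · refine ((dρ.mul dτ.sin).mul dψ.cos).congr_fderiv ?_
      ext w
      simp [M, ρ, τ, ψ, dotProduct, Fin.sum_univ_three]
      ring
    · refine ((dρ.mul dτ.sin).mul dψ.sin).congr_fderiv ?_
      ext w
      simp [M, ρ, τ, ψ, dotProduct, Fin.sum_univ_three]
      ring
  have hcol : ∀ m, ∃ i j, ∀ v, ∃ a b : ℝ, a ^ 2 ≤ 1 ∧ b ^ 2 ≤ 1 ∧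
      (M v).col m = a • (Afields R).get i (Ψ v) + b • (Afields R).get j (Ψ v) := by
    intro m
    fin_cases m
    · refine ⟨⟨6, by simp [Afields]⟩, ⟨6, by simp [Afields]⟩, fun v =>
        ⟨1, 0, by simp, by simp, ?_⟩⟩
      ext k
      fin_cases k <;> simp [M, Ψ, Afields]
    · refine ⟨⟨4, by simp [Afields]⟩, ⟨5, by simp [Afields]⟩, fun v =>
        ⟨σ * Real.cos (ψ v), σ * Real.sin (ψ v), ?_, ?_, ?_⟩⟩
      · rw [mul_pow, hσ, one_mul]
        exact Real.cos_sq_le_one _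
      · rw [mul_pow, hσ, one_mul]
        exact Real.sin_sq_le_one _
      ext k
      fin_cases k <;> simp [M, Ψ, Afields]
      · linear_combination (σ * R⁻¹ * (ρ v * Real.sin (τ v))) * Real.sin_sq_add_cos_sq (ψ v)
      · ring
      · ring
    · refine ⟨⟨3, by simp [Afields]⟩, ⟨3, by simp [Afields]⟩, fun v =>
        ⟨1, 0, by simp, by simp, ?_⟩⟩
      ext k
      fin_cases k <;> simp [M, Ψ, Afields]
  have hτ : ∀ v ∈ Set.univ.pi (fun _ : Fin 3 => Set.Ioc (0 : ℝ) 1),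
      τ v ∈ Set.Icc 0 Real.pi ∧ c ≤ Real.sin (τ v) := fun v hv => hθ _ (hv 1 trivial)
  have hinj : Set.InjOn Ψ (Set.univ.pi fun _ => Set.Ioc 0 1) := by
    intro v hv w hw h
    obtain ⟨tv, sv⟩ := hτ v hv
    obtain ⟨tw, sw⟩ := hτ w hw
    have e0 : ρ v * Real.cos (τ v) = ρ w * Real.cos (τ w) := congrFun h 0
    obtain ⟨h1, h2⟩ := polar_injOn (mul_pos (hρ v) (hc.trans_le sv))
      (mul_pos (hρ w) (hc.trans_le sw)) (hv 2 trivial) (hw 2 trivial)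
      (congrFun h 1) (congrFun h 2)
    have h3 : ρ v = ρ w := by
      refine (sq_eq_sq₀ (hρ v).le (hρ w).le).1 ?_
      linear_combination (-(ρ v ^ 2)) * Real.sin_sq_add_cos_sq (τ v) +
        (ρ w ^ 2) * Real.sin_sq_add_cos_sq (τ w) +
        (ρ v * Real.cos (τ v) + ρ w * Real.cos (τ w)) * e0 +
        (ρ v * Real.sin (τ v) + ρ w * Real.sin (τ w)) * h1
    have h4 : τ v = τ w := by
      rw [h3] at e0
      exact Real.injOn_cos tv tw (mul_left_cancel₀ (hρ w).ne' e0)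
    have hσ0 : σ ≠ 0 := by
      rintro rfl
      norm_num at hσ
    ext k
    fin_cases k
    · simpa [ρ, hr.ne', hR.ne'] using h3
    · simpa [τ, hσ0, hR.ne'] using h4
    · exact h2
  have hdet : ∀ v ∈ Set.univ.pi (fun _ : Fin 3 => Set.Ioc (0 : ℝ) 1),
      r ^ 3 * c * R⁻¹ ^ 2 ≤ |(M v).det| := by
    intro v hv
    have hd : (M v).det = σ * (ρ v ^ 3 * Real.sin (τ v) * R⁻¹ ^ 2) := by
      simp only [M, Matrix.det_fin_three, Matrix.of_apply, Matrix.cons_val]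
      linear_combination (σ * R⁻¹ ^ 2 * ρ v ^ 3 * Real.sin (τ v)) *
        (Real.sin_sq_add_cos_sq (τ v) + (Real.sin (τ v) ^ 2 + Real.cos (τ v) ^ 2) *
          Real.sin_sq_add_cos_sq (ψ v))
    have hσ' : |σ| = 1 := by rw [← sq_eq_sq₀ (abs_nonneg _) zero_le_one, sq_abs, hσ, one_pow]
    have hs := (hτ v hv).2
    have hrρ : r ≤ ρ v := by
      refine le_mul_of_one_le_right hr.le (Real.one_le_exp ?_)
      exact mul_nonneg (inv_nonneg.2 hR.le) (hv 0 trivial).1.le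
    rw [hd, abs_mul, hσ', one_mul]
    refine le_trans ?_ (le_abs_self _)
    gcongr
  have := sq_le_of_coordinates (R := R) (by positivity) hf hfc hΨ hM hcol hinj hdet
  have hΨ0 : Ψ 0 = r • sphPt θ φ := by
    ext k
    fin_cases k <;> simp [Ψ, ρ, τ, ψ, sphPt, mul_assoc]
  rwa [hΨ0] at this

/-- Lemma 6.1, `R`-weighted Sobolev inequality on spheres: away from the
x-axis (polar angle `θ ∈ [π/8, 7π/8]`), `|f|² ≤ C (R/r²) Σ_{|I| ≤ 3} ‖V^I f‖²_{L²(ℝ³)}`. -/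
theorem sphere_sobolev :
    ∃ C > (0 : ℝ), ∀ R : ℝ, 1 ≤ R → ∀ f : Sp → ℝ,
      ContDiff ℝ (⊤ : ℕ∞) f → HasCompactSupport f →
      ∀ r θ φ : ℝ, 0 < r →
        θ ∈ Set.Icc (Real.pi / 8) (7 * Real.pi / 8) → φ ∈ Set.Ico 0 (2 * Real.pi) →
        (f (r • sphPt θ φ)) ^ 2 ≤
          C * (R / r ^ 2) *
            ∑ k ∈ Finset.range 4, ∑ I : Fin k → Fin (Afields R).length,
              ∫ x : Sp, (svIter ((List.ofFn I).map (Afields R).get) f x) ^ 2 := by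
  have hc : 0 < Real.sin (Real.pi / 8) :=
    Real.sin_pos_of_pos_of_lt_pi (by linarith [Real.pi_pos]) (by linarith [Real.pi_pos])
  refine ⟨216 / Real.sin (Real.pi / 8), by positivity, ?_⟩
  intro R hR f hf hfc r θ φ hr hθ _
  set c := Real.sin (Real.pi / 8) with hcdef
  have hR0 : 0 < R := by linarith
  have hS : 0 ≤ ∑ k ∈ Finset.range 4, ∑ I : Fin k → Fin (Afields R).length,
      ∫ x : Sp, (svIter ((List.ofFn I).map (Afields R).get) f x) ^ 2 :=
    Finset.sum_nonneg fun _ _ => Finset.sum_nonneg fun _ _ => integral_nonneg fun _ => sq_nonneg _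
  rcases le_total r R with hrR | hrR
  · have hs : c ≤ Real.sin θ := sin_pi_div_eight_le hθ.1 hθ.2
    have h := sq_le_of_cylindrical R (r * Real.cos θ) (r * Real.sin θ) φ
      (mul_pos hr (hc.trans_le hs)) hf hfc
    have hp : r • sphPt θ φ = ![r * Real.cos θ, r * Real.sin θ * Real.cos φ,
        r * Real.sin θ * Real.sin φ] := by
      ext k
      fin_cases k <;> simp [sphPt, mul_assoc]
    rw [hp]
    refine h.trans (mul_le_mul_of_nonneg_right ?_ hS)
    calc 216 / (r * Real.sin θ) ≤ 216 / (r * c) := by gcongr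
      _ = 216 / c * (r / r ^ 2) := by field_simp
      _ ≤ 216 / c * (R / r ^ 2) := by gcongr
  · obtain ⟨σ, hσ, hθσ⟩ : ∃ σ : ℝ, σ ^ 2 = 1 ∧ ∀ u ∈ Set.Icc (0 : ℝ) 1,
        θ + σ * u ∈ Set.Icc (Real.pi / 8) (7 * Real.pi / 8) := by
      have hpi := Real.pi_gt_three
      rcases le_total θ (Real.pi / 2) with h | h
      · exact ⟨1, by norm_num, fun u hu =>
          ⟨by linarith [hu.1, hθ.1], by linarith [hu.2]⟩⟩
      · exact ⟨-1, by norm_num, fun u hu =>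
          ⟨by linarith [hu.2], by linarith [hu.1, hθ.2]⟩⟩
    have h := sq_le_of_spherical (θ := θ) φ hR0 hr hc hσ (fun t ht => by
      have hu : R⁻¹ * t ∈ Set.Icc (0 : ℝ) 1 :=
        ⟨mul_nonneg (inv_nonneg.2 hR0.le) ht.1.le,
          mul_le_one₀ (inv_le_one_of_one_le₀ hR) ht.1.le ht.2⟩
      have hm := hθσ _ hu
      have hpi := Real.pi_pos
      exact ⟨⟨by linarith [hm.1], by linarith [hm.2]⟩, sin_pi_div_eight_le hm.1 hm.2⟩) hf hfc
    refine h.trans (mul_le_mul_of_nonneg_right ?_ hS)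
    calc 216 / (r ^ 3 * c * R⁻¹ ^ 2) = 216 / c * (R * R / (r ^ 2 * r)) := by
          field_simp
      _ ≤ 216 / c * (R * r / (r ^ 2 * r)) := by gcongr
      _ = 216 / c * (R / r ^ 2) := by field_simp

end
end

section
/- There exists a constant C > 0 such that the following holds for every R ≥ 1 and every a ∈ ℝ. Let f : ℝ^{1+3} → ℝ be smooth and compactly supported. For every point (t,x,y,z) with t ≥ 1 and ρ := √(y²+z²) ≤ t/10, setting τ = √(t² − ρ²): |f(t,x,y,z)| ≤ (C/t) · Σ_{I, |I| ≤ 3} ‖V^I f‖_{L²(H_τ ∩ {ρ ≤ t/10})}, where the sum runs over all lists I of at most 3 vector fields from Γ^{(a)}, and H_τ is the x-translation-invariant hyperboloid {(s,x',y',z') : s > 0, s² − y'² − z'² = τ²}. -/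
open MeasureTheory

noncomputable section

/-- The squared `L²` norm of `f` on the part of the `x`-translation-invariant hyperboloid
`H_τ = {t² − y² − z² = τ², t > 0}` where `ρ = √(y²+z²) ≤ t/10`, computed in the parameters
`(α, x, φ)` with induced measure `τ² sinh α dα dx dφ`. -/
def hypL2 (f : Pt → ℝ) (τ : ℝ) : ℝ :=
  Real.sqrt (∫ z : ℝ × ℝ × ℝ in
      {z | 0 ≤ z.1 ∧ z.2.2 ∈ Set.Ico 0 (2 * Real.pi) ∧
           τ * Real.sinh z.1 ≤ τ * Real.cosh z.1 / 10},
    (f (hpt τ z.1 z.2.1 z.2.2)) ^ 2 * (τ ^ 2 * Real.sinh z.1))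

/-- The point of `H_τ` whose `(y, z)` part is `τ` times the rotation of `(u, v)` by `θ`. -/
def cartPt (τ θ u v x : ℝ) : Pt :=
  ![τ * √(1 + u ^ 2 + v ^ 2), x, τ * (Real.cos θ * u - Real.sin θ * v),
    τ * (Real.sin θ * u + Real.cos θ * v)]

theorem continuous_cartPt (τ θ : ℝ) :
    Continuous fun q : ℝ × ℝ × ℝ => cartPt τ θ q.1 q.2.1 q.2.2 := by
  unfold cartPt
  refine continuous_pi fun i => ?_
  fin_cases i <;> simp <;> fun_prop

theorem sq_le_lintegral_sq_add_sq {g g' D : ℝ → ℝ} (hg : ∀ s, HasDerivAt g (g' s) s)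
    (hg' : Continuous g') (hD : Continuous D) (hgD : ∀ s, g s ^ 2 + g' s ^ 2 ≤ D s) (b : ℝ) :
    ENNReal.ofReal (g b ^ 2) ≤
      21 * ∫⁻ s in Set.Ioc (b - 1 / 20) b, ENNReal.ofReal (D s) := by
  have hgc : Continuous g := continuous_iff_continuousAt.2 fun s => (hg s).continuousAt
  have hder : ∀ s, HasDerivAt (fun s => (s - (b - 1 / 20)) * g s ^ 2)
      (g s ^ 2 + (s - (b - 1 / 20)) * (2 * g s * g' s)) s := fun s => by
    have := ((hasDerivAt_id s).sub_const (b - 1 / 20)).mul ((hg s).pow 2)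
    refine this.congr_deriv ?_
    simp
  have hcont : Continuous fun s => g s ^ 2 + (s - (b - 1 / 20)) * (2 * g s * g' s) := by fun_prop
  have hftc := intervalIntegral.integral_eq_sub_of_hasDerivAt (a := b - 1 / 20) (b := b)
    (fun s _ => hder s) (hcont.intervalIntegrable _ _)
  have hmono : ∫ s in (b - 1 / 20)..b, (g s ^ 2 + (s - (b - 1 / 20)) * (2 * g s * g' s)) ≤
      ∫ s in (b - 1 / 20)..b, 21 / 20 * D s := by
    refine intervalIntegral.integral_mono_on (by linarith) (hcont.intervalIntegrable _ _)
      ((continuous_const.mul hD).intervalIntegrable _ _) fun s hs => ?_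
    have h1 : 2 * g s * g' s ≤ g s ^ 2 + g' s ^ 2 := two_mul_le_add_sq _ _
    have h2 : (s - (b - 1 / 20)) * (2 * g s * g' s) ≤
        (s - (b - 1 / 20)) * (g s ^ 2 + g' s ^ 2) :=
      mul_le_mul_of_nonneg_left h1 (by linarith [hs.1])
    have h3 : (s - (b - 1 / 20)) * (g s ^ 2 + g' s ^ 2) ≤ 1 / 20 * (g s ^ 2 + g' s ^ 2) :=
      mul_le_mul_of_nonneg_right (by linarith [hs.2]) (by positivity)
    nlinarith [hgD s, sq_nonneg (g' s)]
  rw [intervalIntegral.integral_const_mul] at hmono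
  have hle : g b ^ 2 ≤ 21 * ∫ s in Set.Ioc (b - 1 / 20) b, D s := by
    rw [← intervalIntegral.integral_of_le (by linarith)]
    simp only [sub_self, zero_mul, sub_zero] at hftc
    linarith
  have hD0 : ∀ s, 0 ≤ D s := fun s => le_trans (by positivity) (hgD s)
  calc ENNReal.ofReal (g b ^ 2)
      ≤ ENNReal.ofReal (21 * ∫ s in Set.Ioc (b - 1 / 20) b, D s) := ENNReal.ofReal_le_ofReal hle
    _ = _ := by
      rw [ENNReal.ofReal_mul (by norm_num), ofReal_integral_eq_lintegral_ofReal
        (hD.integrableOn_Ioc) (Filter.Eventually.of_forall hD0)]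
      norm_num

theorem sq_le_lintegral_comp_curve {h : Pt → ℝ} (hh : ContDiff ℝ (⊤ : ℕ∞) h) {γ γ' : ℝ → Pt}
    (hγ : ∀ s, HasDerivAt γ (γ' s) s) (hγ' : Continuous γ') {D : ℝ → ℝ} (hD : Continuous D)
    (hle : ∀ s, h (γ s) ^ 2 + (fderiv ℝ h (γ s) (γ' s)) ^ 2 ≤ D s) (b : ℝ) :
    ENNReal.ofReal (h (γ b) ^ 2) ≤
      21 * ∫⁻ s in Set.Ioc (b - 1 / 20) b, ENNReal.ofReal (D s) := by
  have hγc : Continuous γ := continuous_iff_continuousAt.2 fun s => (hγ s).continuousAt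
  refine sq_le_lintegral_sq_add_sq (g := fun s => h (γ s))
    (g' := fun s => fderiv ℝ h (γ s) (γ' s)) (fun s => ?_) ?_ hD hle b
  · exact ((hh.differentiable (by simp)).differentiableAt.hasFDerivAt).comp_hasDerivAt s (hγ s)
  · exact ((hh.continuous_fderiv (by simp)).comp hγc).clm_apply hγ'

theorem contDiff_vApp {X : Pt → Pt} {h : Pt → ℝ} (hX : ContDiff ℝ (⊤ : ℕ∞) X)
    (hh : ContDiff ℝ (⊤ : ℕ∞) h) : ContDiff ℝ (⊤ : ℕ∞) (vApp X h) :=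
  (hh.fderiv_right (by simp)).clm_apply hX

theorem contDiff_boostVF (q : Sp) (i : Fin 3) : ContDiff ℝ (⊤ : ℕ∞) (boostVF q i) := by
  unfold boostVF
  fun_prop

theorem contDiff_transVF (i : Fin 4) : ContDiff ℝ (⊤ : ℕ∞) (transVF i) := contDiff_const

theorem hasDerivAt_cartPt_fst (τ θ a v x u : ℝ) :
    HasDerivAt (fun u => cartPt τ θ u v x)
      ((√(1 + u ^ 2 + v ^ 2))⁻¹ • (Real.cos θ • boostVF (axisPt a) 1 (cartPt τ θ u v x) +
        Real.sin θ • boostVF (axisPt a) 2 (cartPt τ θ u v x))) u := by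
  have hpos : 0 < 1 + u ^ 2 + v ^ 2 := by positivity
  have hw : √(1 + u ^ 2 + v ^ 2) ≠ 0 := (Real.sqrt_pos.2 hpos).ne'
  have hcs := Real.sin_sq_add_cos_sq θ
  refine hasDerivAt_pi.2 fun i => ?_
  fin_cases i
  · have h := ((((hasDerivAt_id u).pow 2).const_add 1).add_const (v ^ 2)).sqrt hpos.ne'
    refine (h.const_mul τ).congr_deriv ?_
    simp [boostVF, cartPt, axisPt, sidx]
    field_simp
    linear_combination (-τ * u) * hcs
  · refine (hasDerivAt_const u x).congr_deriv ?_
    simp [boostVF, cartPt, axisPt, sidx]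
  · have h := ((hasDerivAt_id u).const_mul (Real.cos θ)).sub_const (Real.sin θ * v)
    refine (h.const_mul τ).congr_deriv ?_
    simp [boostVF, cartPt, axisPt, sidx]
    field_simp
  · have h := ((hasDerivAt_id u).const_mul (Real.sin θ)).add_const (Real.cos θ * v)
    refine (h.const_mul τ).congr_deriv ?_
    simp [boostVF, cartPt, axisPt, sidx]
    field_simp

theorem cartPt_swap (τ θ u v x : ℝ) :
    cartPt τ θ u v x = cartPt τ (θ + Real.pi / 2) v (-u) x := by
  simp [cartPt, Real.cos_add_pi_div_two, Real.sin_add_pi_div_two]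
  refine ⟨Or.inl (by ring_nf), Or.inl (by ring), Or.inl (by ring)⟩

theorem lintegral_cartPt_fst {h : Pt → ℝ} (hh : ContDiff ℝ (⊤ : ℕ∞) h) (τ θ a v x b : ℝ) :
    ENNReal.ofReal (h (cartPt τ θ b v x) ^ 2) ≤
      21 * ∫⁻ u in Set.Ioc (b - 1 / 20) b, ENNReal.ofReal (h (cartPt τ θ u v x) ^ 2 +
        vApp (boostVF (axisPt a) 1) h (cartPt τ θ u v x) ^ 2 +
        vApp (boostVF (axisPt a) 2) h (cartPt τ θ u v x) ^ 2) := by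
  have hQ : Continuous fun u => cartPt τ θ u v x :=
    (continuous_cartPt τ θ).comp (by fun_prop : Continuous fun u : ℝ => (u, v, x))
  have hB : ∀ i, Continuous fun u => boostVF (axisPt a) i (cartPt τ θ u v x) := fun i =>
    (contDiff_boostVF _ i).continuous.comp hQ
  have hw : ∀ u : ℝ, 0 < √(1 + u ^ 2 + v ^ 2) := fun u => Real.sqrt_pos.2 (by positivity)
  have hw1 : ∀ u : ℝ, 1 ≤ √(1 + u ^ 2 + v ^ 2) := fun u =>
    Real.one_le_sqrt.2 (by nlinarith [sq_nonneg u, sq_nonneg v])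
  refine sq_le_lintegral_comp_curve hh (hasDerivAt_cartPt_fst τ θ a v x) ?_ ?_ (fun u => ?_) b
  · refine Continuous.smul (Continuous.inv₀ (by fun_prop) fun u => (hw u).ne') ?_
    exact ((hB 1).const_smul (Real.cos θ)).add ((hB 2).const_smul (Real.sin θ))
  · have hV : ∀ i, Continuous fun u => vApp (boostVF (axisPt a) i) h (cartPt τ θ u v x) :=
      fun i => (contDiff_vApp (contDiff_boostVF _ i) hh).continuous.comp hQ
    exact (((hh.continuous.comp hQ).pow 2).add ((hV 1).pow 2)).add ((hV 2).pow 2)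
  · rw [map_smul, map_add, map_smul, map_smul, add_assoc (h (cartPt τ θ u v x) ^ 2)]
    change _ + (_ * (_ * vApp (boostVF (axisPt a) 1) h (cartPt τ θ u v x) +
      _ * vApp (boostVF (axisPt a) 2) h (cartPt τ θ u v x))) ^ 2 ≤ _
    generalize vApp (boostVF (axisPt a) 1) h (cartPt τ θ u v x) = A
    generalize vApp (boostVF (axisPt a) 2) h (cartPt τ θ u v x) = B
    gcongr
    have h1 : ((√(1 + u ^ 2 + v ^ 2))⁻¹) ^ 2 ≤ 1 :=
      pow_le_one₀ (by positivity) (inv_le_one_of_one_le₀ (hw1 u))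
    have h2 : (Real.cos θ * A + Real.sin θ * B) ^ 2 ≤ A ^ 2 + B ^ 2 := by
      have : (Real.cos θ ^ 2 + Real.sin θ ^ 2) * (A ^ 2 + B ^ 2) = A ^ 2 + B ^ 2 := by
        rw [Real.cos_sq_add_sin_sq, one_mul]
      nlinarith [sq_nonneg (Real.cos θ * B - Real.sin θ * A)]
    rw [mul_pow]
    calc _ ≤ 1 * (Real.cos θ * A + Real.sin θ * B) ^ 2 := by gcongr
      _ ≤ _ := by linarith

theorem lintegral_cartPt_snd {h : Pt → ℝ} (hh : ContDiff ℝ (⊤ : ℕ∞) h) (τ θ a u x b : ℝ) :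
    ENNReal.ofReal (h (cartPt τ θ u b x) ^ 2) ≤
      21 * ∫⁻ v in Set.Ioc (b - 1 / 20) b, ENNReal.ofReal (h (cartPt τ θ u v x) ^ 2 +
        vApp (boostVF (axisPt a) 1) h (cartPt τ θ u v x) ^ 2 +
        vApp (boostVF (axisPt a) 2) h (cartPt τ θ u v x) ^ 2) := by
  simp only [cartPt_swap τ θ u]
  exact lintegral_cartPt_fst hh τ (θ + Real.pi / 2) a (-u) x b

theorem lintegral_cartPt_thd {h : Pt → ℝ} (hh : ContDiff ℝ (⊤ : ℕ∞) h) (τ θ u v b : ℝ) :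
    ENNReal.ofReal (h (cartPt τ θ u v b) ^ 2) ≤
      21 * ∫⁻ x in Set.Ioc (b - 1 / 20) b, ENNReal.ofReal (h (cartPt τ θ u v x) ^ 2 +
        vApp (transVF 1) h (cartPt τ θ u v x) ^ 2) := by
  have hQ : Continuous fun x => cartPt τ θ u v x :=
    (continuous_cartPt τ θ).comp (by fun_prop : Continuous fun x : ℝ => (u, v, x))
  refine sq_le_lintegral_comp_curve hh (γ' := fun _ => Pi.single 1 1) (fun x => ?_)
    continuous_const ?_ (fun x => le_rfl) b
  · refine hasDerivAt_pi.2 fun i => ?_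
    fin_cases i
    · exact (hasDerivAt_const x _).congr_deriv (by simp)
    · exact (hasDerivAt_id x).congr_deriv (by simp)
    · exact (hasDerivAt_const x _).congr_deriv (by simp)
    · exact (hasDerivAt_const x _).congr_deriv (by simp)
  · exact ((hh.continuous.comp hQ).pow 2).add
      (((contDiff_vApp (contDiff_transVF 1) hh).continuous.comp hQ).pow 2)

theorem lintegral_Ioo_eq_lintegral_Ico_sub {g : ℝ → ENNReal}
    (hg : Function.Periodic g (2 * Real.pi)) (θ : ℝ) :
    ∫⁻ φ in Set.Ioo (-Real.pi) Real.pi, g φ =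
      ∫⁻ φ in Set.Ico 0 (2 * Real.pi), g (φ - θ) := by
  have hpi : 0 < 2 * Real.pi := Real.two_pi_pos
  have hdom : ∫⁻ φ in Set.Ioc (-Real.pi) (-Real.pi + 2 * Real.pi), g φ =
      ∫⁻ φ in Set.Ioc (-θ) (-θ + 2 * Real.pi), g φ := by
    have : VAddInvariantMeasure (AddSubgroup.zmultiples (2 * Real.pi)) ℝ volume :=
      ⟨fun c s _ => measure_preimage_add _ _ _⟩
    apply IsAddFundamentalDomain.setLIntegral_eq (G := AddSubgroup.zmultiples (2 * Real.pi))
    exacts [isAddFundamentalDomain_Ioc hpi _, isAddFundamentalDomain_Ioc hpi _,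
      hg.map_vadd_zmultiples]
  have hshift := (measurePreserving_sub_right volume θ).setLIntegral_comp_preimage_emb
    (measurableEmbedding_subRight θ) g (Set.Ioc (-θ) (-θ + 2 * Real.pi))
  rw [Set.preimage_sub_const_Ioc, neg_add_cancel,
    show -θ + 2 * Real.pi + θ = 2 * Real.pi by ring] at hshift
  rw [setLIntegral_congr Ioo_ae_eq_Ioc, setLIntegral_congr Ico_ae_eq_Ioc, hshift, ← hdom,
    show -Real.pi + 2 * Real.pi = Real.pi by ring]

/-- The values of `α` for which the points of `H_τ` satisfy `ρ ≤ t / 10`. -/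
def coneAngles : Set ℝ := {α | 0 ≤ α ∧ Real.sinh α ≤ Real.cosh α / 10}

theorem measurableSet_coneAngles : MeasurableSet coneAngles :=
  ((isClosed_le continuous_const continuous_id).inter
    (isClosed_le Real.continuous_sinh (Real.continuous_cosh.div_const 10))).measurableSet

theorem sinh_nonneg_of_mem_coneAngles {α : ℝ} (hα : α ∈ coneAngles) : 0 ≤ Real.sinh α :=
  Real.sinh_nonneg_iff.2 hα.1

theorem le_one_of_mem_coneAngles {α : ℝ} (hα : α ∈ coneAngles) : α ≤ 1 := by
  have h0 := sinh_nonneg_of_mem_coneAngles hα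
  have h1 := Real.self_le_sinh_iff.2 hα.1
  have h2 := Real.cosh_sq α
  have h3 := hα.2
  have h4 := Real.cosh_pos α
  nlinarith

theorem lintegral_eq_lintegral_sinh_polar {G : ℝ × ℝ → ENNReal} (hG : Measurable G) (θ : ℝ) :
    ∫⁻ p, G p = ∫⁻ α in Set.Ioi (0 : ℝ), ENNReal.ofReal (Real.cosh α) *
      (ENNReal.ofReal (Real.sinh α) * ∫⁻ φ in Set.Ico 0 (2 * Real.pi),
        G (Real.sinh α * Real.cos (φ - θ), Real.sinh α * Real.sin (φ - θ))) := by
  have himage : Real.sinh '' Set.Ioi 0 = Set.Ioi 0 := by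
    ext r
    constructor
    · rintro ⟨α, hα, rfl⟩
      exact Real.sinh_pos_iff.2 hα
    · intro hr
      exact ⟨Real.arsinh r, Real.arsinh_pos_iff.2 hr, Real.sinh_arsinh r⟩
  rw [← lintegral_comp_polarCoord_symm, polarCoord_target, Measure.volume_eq_prod,
    setLIntegral_prod]
  · have hinner : ∀ r : ℝ, ∫⁻ φ in Set.Ioo (-Real.pi) Real.pi,
        ENNReal.ofReal r • G (polarCoord.symm (r, φ)) =
        ENNReal.ofReal r * ∫⁻ φ in Set.Ico 0 (2 * Real.pi),
          G (r * Real.cos (φ - θ), r * Real.sin (φ - θ)) := fun r => by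
      simp only [polarCoord_symm_apply, smul_eq_mul]
      rw [lintegral_const_mul' _ _ ENNReal.ofReal_ne_top]
      congr 1
      exact lintegral_Ioo_eq_lintegral_Ico_sub
        (g := fun φ => G (r * Real.cos φ, r * Real.sin φ)) (fun φ => by simp) θ
    simp only [hinner]
    conv_lhs => rw [← himage, lintegral_image_eq_lintegral_abs_deriv_mul measurableSet_Ioi
      (fun x _ => (Real.hasDerivAt_sinh x).hasDerivWithinAt) Real.sinh_injective.injOn]
    simp only [abs_of_pos (Real.cosh_pos _)]
  · refine Measurable.aemeasurable ?_
    have := continuous_polarCoord_symm.measurable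
    simp only [smul_eq_mul]
    fun_prop

theorem lintegral_box_le_lintegral_polar {F : ℝ × ℝ → ENNReal} (hF : Measurable F) (θ : ℝ)
    {b : ℝ} (hb : 0 ≤ b) (hb' : b ^ 2 ≤ 1 / 198) :
    ∫⁻ u in Set.Ioc (b - 1 / 20) b, ∫⁻ v in Set.Ioc (b - 1 / 20) b, F (u, v) ≤
      2 * ∫⁻ α in coneAngles, ENNReal.ofReal (Real.sinh α) *
        ∫⁻ φ in Set.Ico 0 (2 * Real.pi),
          F (Real.sinh α * Real.cos (φ - θ), Real.sinh α * Real.sin (φ - θ)) := by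
  set B : Set (ℝ × ℝ) := {p | p.1 ^ 2 + p.2 ^ 2 ≤ 1 / 99} with hB
  have hBm : MeasurableSet B :=
    measurableSet_le (by fun_prop) measurable_const
  have hsub : Set.Ioc (b - 1 / 20) b ×ˢ Set.Ioc (b - 1 / 20) b ⊆ B := by
    have key : ∀ s ∈ Set.Ioc (b - 1 / 20) b, s ^ 2 ≤ 1 / 198 := fun s hs => by
      rcases le_total 0 s with h | h
      · nlinarith [hs.2]
      · nlinarith [hs.1]
    rintro ⟨u, v⟩ ⟨hu, hv⟩
    have := key u hu
    have := key v hv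
    simp only [hB, Set.mem_ofPred_eq]
    linarith
  rw [← setLIntegral_prod _ hF.aemeasurable, ← Measure.volume_eq_prod]
  calc ∫⁻ p in Set.Ioc (b - 1 / 20) b ×ˢ Set.Ioc (b - 1 / 20) b, F p
      ≤ ∫⁻ p in B, F p := lintegral_mono_set hsub
    _ = ∫⁻ p, B.indicator F p := (lintegral_indicator hBm F).symm
    _ = _ := lintegral_eq_lintegral_sinh_polar (hF.indicator hBm) θ
    _ ≤ ∫⁻ α in Set.Ioi (0 : ℝ), coneAngles.indicator (fun α => 2 * (ENNReal.ofReal (Real.sinh α) *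
        ∫⁻ φ in Set.Ico 0 (2 * Real.pi),
          F (Real.sinh α * Real.cos (φ - θ), Real.sinh α * Real.sin (φ - θ)))) α := by
      refine setLIntegral_mono' measurableSet_Ioi fun α hα => ?_
      have hmem : ∀ φ, (Real.sinh α * Real.cos (φ - θ), Real.sinh α * Real.sin (φ - θ)) ∈ B ↔
          Real.sinh α ^ 2 ≤ 1 / 99 := fun φ => by
        simp only [hB, Set.mem_ofPred_eq]
        rw [mul_pow, mul_pow, ← mul_add, Real.cos_sq_add_sin_sq, mul_one]
      by_cases hs : Real.sinh α ^ 2 ≤ 1 / 99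
      · have hcosh := Real.cosh_sq α
        have hcpos := Real.cosh_pos α
        have hcone : α ∈ coneAngles := by
          refine ⟨le_of_lt hα, ?_⟩
          refine le_of_sq_le_sq ?_ (by positivity)
          rw [div_pow, hcosh]
          linarith
        rw [Set.indicator_of_mem hcone]
        gcongr
        · rw [ENNReal.ofReal_le_ofNat]
          nlinarith
        · exact Set.indicator_le_self _ _ _
      · have hz : ∀ φ, B.indicator F
            (Real.sinh α * Real.cos (φ - θ), Real.sinh α * Real.sin (φ - θ)) = 0 := fun φ =>
          Set.indicator_of_notMem (fun h => hs ((hmem φ).1 h)) _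
        simp [hz]
    _ ≤ ∫⁻ α, coneAngles.indicator (fun α => 2 * (ENNReal.ofReal (Real.sinh α) *
        ∫⁻ φ in Set.Ico 0 (2 * Real.pi),
          F (Real.sinh α * Real.cos (φ - θ), Real.sinh α * Real.sin (φ - θ)))) α :=
      setLIntegral_le_lintegral _ _
    _ = _ := by
      rw [lintegral_indicator measurableSet_coneAngles, lintegral_const_mul' _ _ (by simp)]

theorem continuous_hpt (τ : ℝ) : Continuous fun z : ℝ × ℝ × ℝ => hpt τ z.1 z.2.1 z.2.2 := by
  unfold hpt
  refine continuous_pi fun i => ?_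
  fin_cases i <;> simp <;> fun_prop

theorem cartPt_polar (τ θ α x φ : ℝ) :
    cartPt τ θ (Real.sinh α * Real.cos (φ - θ)) (Real.sinh α * Real.sin (φ - θ)) x =
      hpt τ α x φ := by
  have h1 : 1 + (Real.sinh α * Real.cos (φ - θ)) ^ 2 + (Real.sinh α * Real.sin (φ - θ)) ^ 2 =
      Real.cosh α ^ 2 := by
    rw [Real.cosh_sq]
    linear_combination Real.sinh α ^ 2 * Real.cos_sq_add_sin_sq (φ - θ)
  have h2 : Real.cos φ = Real.cos θ * Real.cos (φ - θ) - Real.sin θ * Real.sin (φ - θ) := by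
    rw [← Real.cos_add, add_sub_cancel]
  have h3 : Real.sin φ = Real.sin θ * Real.cos (φ - θ) + Real.cos θ * Real.sin (φ - θ) := by
    rw [← Real.sin_add, add_sub_cancel]
  unfold cartPt hpt
  rw [h1, Real.sqrt_sq (Real.cosh_pos α).le]
  congr 3
  · linear_combination (-τ * Real.sinh α) * h2
  · congr 1
    linear_combination (-τ * Real.sinh α) * h3

theorem ofReal_hypL2_sq {h : Pt → ℝ} (hc : Continuous h) (hs : HasCompactSupport h) {τ : ℝ}
    (hτ : 0 < τ) :
    ENNReal.ofReal (hypL2 h τ ^ 2) =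
      ∫⁻ α in coneAngles, ∫⁻ x, ∫⁻ φ in Set.Ico 0 (2 * Real.pi),
        ENNReal.ofReal (h (hpt τ α x φ) ^ 2 * (τ ^ 2 * Real.sinh α)) := by
  have hregion : {z : ℝ × ℝ × ℝ | 0 ≤ z.1 ∧ z.2.2 ∈ Set.Ico 0 (2 * Real.pi) ∧
      τ * Real.sinh z.1 ≤ τ * Real.cosh z.1 / 10} =
      coneAngles ×ˢ (Set.univ ×ˢ Set.Ico 0 (2 * Real.pi)) := by
    ext ⟨α, x, φ⟩
    have : τ * Real.sinh α ≤ τ * Real.cosh α / 10 ↔ Real.sinh α ≤ Real.cosh α / 10 := by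
      rw [mul_div_assoc, mul_le_mul_iff_right₀ hτ]
    simp only [Set.mem_ofPred_eq, Set.mem_prod, Set.mem_univ, true_and, coneAngles, this]
    tauto
  have hm : MeasurableSet (coneAngles ×ˢ ((Set.univ : Set ℝ) ×ˢ Set.Ico 0 (2 * Real.pi))) :=
    measurableSet_coneAngles.prod (MeasurableSet.univ.prod measurableSet_Ico)
  have hcont : Continuous fun z : ℝ × ℝ × ℝ =>
      h (hpt τ z.1 z.2.1 z.2.2) ^ 2 * (τ ^ 2 * Real.sinh z.1) := by
    have := hc.comp (continuous_hpt τ)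
    exact (this.pow 2).mul (by fun_prop)
  obtain ⟨M, hM⟩ := hs.isCompact.isBounded.exists_norm_le
  have hint : IntegrableOn (fun z : ℝ × ℝ × ℝ =>
      h (hpt τ z.1 z.2.1 z.2.2) ^ 2 * (τ ^ 2 * Real.sinh z.1))
      (coneAngles ×ˢ ((Set.univ : Set ℝ) ×ˢ Set.Ico 0 (2 * Real.pi))) := by
    have hK : IntegrableOn (fun z : ℝ × ℝ × ℝ =>
        h (hpt τ z.1 z.2.1 z.2.2) ^ 2 * (τ ^ 2 * Real.sinh z.1))
        (Set.Icc 0 1 ×ˢ (Set.Icc (-M) M ×ˢ Set.Icc 0 (2 * Real.pi))) :=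
      hcont.continuousOn.integrableOn_compact
        (isCompact_Icc.prod (isCompact_Icc.prod isCompact_Icc))
    refine hK.of_forall_sdiff_eq_zero hm ?_
    rintro ⟨α, x, φ⟩ ⟨⟨hα, -, hφ⟩, hout⟩
    have hzero : h (hpt τ α x φ) = 0 := by
      by_contra hne
      have h1 := hM _ (subset_tsupport h hne)
      have h2 : |x| ≤ M := (norm_le_pi_norm (hpt τ α x φ) 1).trans h1
      exact hout ⟨⟨hα.1, le_one_of_mem_coneAngles hα⟩, abs_le.1 h2, hφ.1, hφ.2.le⟩
    simp [hzero]
  have hnn : ∀ z ∈ coneAngles ×ˢ ((Set.univ : Set ℝ) ×ˢ Set.Ico 0 (2 * Real.pi)),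
      0 ≤ h (hpt τ z.1 z.2.1 z.2.2) ^ 2 * (τ ^ 2 * Real.sinh z.1) := fun z hz => by
    have := sinh_nonneg_of_mem_coneAngles hz.1
    positivity
  have hmeas : Measurable fun z : ℝ × ℝ × ℝ =>
      ENNReal.ofReal (h (hpt τ z.1 z.2.1 z.2.2) ^ 2 * (τ ^ 2 * Real.sinh z.1)) :=
    hcont.measurable.ennreal_ofReal
  unfold hypL2
  rw [hregion, Real.sq_sqrt (setIntegral_nonneg hm hnn),
    ofReal_integral_eq_lintegral_ofReal hint ((ae_restrict_iff' hm).2 (ae_of_all _ hnn)),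
    Measure.volume_eq_prod, setLIntegral_prod _ hmeas.aemeasurable]
  refine lintegral_congr fun α => ?_
  have hslice := hmeas.comp (measurable_prodMk_left (x := α))
  simp only [Function.comp_def] at hslice
  rw [Measure.volume_eq_prod, setLIntegral_prod _ hslice.aemeasurable, Measure.restrict_univ]

theorem measurable_ofReal_sq_cartPt {A : Type*} [MeasurableSpace A] {h : Pt → ℝ}
    (hc : Continuous h) (τ θ : ℝ) {u v x : A → ℝ} (hu : Measurable u) (hv : Measurable v)
    (hx : Measurable x) :
    Measurable fun q => ENNReal.ofReal (h (cartPt τ θ (u q) (v q) (x q)) ^ 2) :=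
  (((hc.comp (continuous_cartPt τ θ)).measurable.comp
    (hu.prodMk (hv.prodMk hx))).pow_const 2).ennreal_ofReal

theorem lintegral_box_le_hypL2 {h : Pt → ℝ} (hc : Continuous h) (hs : HasCompactSupport h)
    {τ : ℝ} (hτ : 0 < τ) (θ c : ℝ) {b : ℝ} (hb : 0 ≤ b) (hb' : b ^ 2 ≤ 1 / 198) :
    ENNReal.ofReal (τ ^ 2) * ∫⁻ u in Set.Ioc (b - 1 / 20) b, ∫⁻ v in Set.Ioc (b - 1 / 20) b,
      ∫⁻ x in Set.Ioc (c - 1 / 20) c, ENNReal.ofReal (h (cartPt τ θ u v x) ^ 2) ≤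
      2 * ENNReal.ofReal (hypL2 h τ ^ 2) := by
  have hcart : Measurable fun q : (ℝ × ℝ) × ℝ =>
      ENNReal.ofReal (h (cartPt τ θ q.1.1 q.1.2 q.2) ^ 2) :=
    measurable_ofReal_sq_cartPt hc τ θ (by fun_prop) (by fun_prop) (by fun_prop)
  have hhpt : ∀ α, Measurable fun q : ℝ × ℝ =>
      ENNReal.ofReal (h (hpt τ α q.2 q.1) ^ 2) := fun α => by
    have := (hc.comp ((continuous_hpt τ).comp
      (by fun_prop : Continuous fun q : ℝ × ℝ => (α, q.2, q.1)))).measurable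
    exact (this.pow_const 2).ennreal_ofReal
  have hpolar := lintegral_box_le_lintegral_polar
    (hcart.lintegral_prod_right' (ν := volume.restrict (Set.Ioc (c - 1 / 20) c))) θ hb hb'
  simp only [cartPt_polar] at hpolar
  rw [ofReal_hypL2_sq hc hs hτ]
  refine (mul_le_mul' le_rfl hpolar).trans ?_
  rw [mul_left_comm]
  gcongr 2 * ?_
  rw [← lintegral_const_mul' _ _ ENNReal.ofReal_ne_top]
  refine setLIntegral_mono' measurableSet_coneAngles fun α hα => ?_
  have hsinh := sinh_nonneg_of_mem_coneAngles hα
  rw [lintegral_lintegral_swap (hhpt α).aemeasurable, ← mul_assoc,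
    ← ENNReal.ofReal_mul (by positivity)]
  calc _ ≤ ENNReal.ofReal (τ ^ 2 * Real.sinh α) * ∫⁻ x,
        ∫⁻ φ in Set.Ico 0 (2 * Real.pi), ENNReal.ofReal (h (hpt τ α x φ) ^ 2) := by
        gcongr
        exact Measure.restrict_le_self
    _ = _ := by
        rw [← lintegral_const_mul' _ _ ENNReal.ofReal_ne_top]
        refine lintegral_congr fun x => ?_
        rw [← lintegral_const_mul' _ _ ENNReal.ofReal_ne_top]
        refine lintegral_congr fun φ => ?_
        rw [← ENNReal.ofReal_mul (by positivity), mul_comm]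

theorem HasCompactSupport.vApp {h : Pt → ℝ} (hs : HasCompactSupport h) (X : Pt → Pt) :
    HasCompactSupport (vApp X h) := by
  refine (hs.fderiv ℝ).mono fun p hp => ?_
  contrapose! hp
  simp only [Function.mem_support, not_not] at hp ⊢
  simp [_root_.vApp, hp]

theorem contDiff_vIter {f : Pt → ℝ} (hf : ContDiff ℝ (⊤ : ℕ∞) f) :
    ∀ {L : List (Pt → Pt)}, (∀ X ∈ L, ContDiff ℝ (⊤ : ℕ∞) X) → ContDiff ℝ (⊤ : ℕ∞) (vIter L f)
  | [], _ => hf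
  | X :: _, hL => contDiff_vApp (hL X (by simp))
      (contDiff_vIter hf fun Y hY => hL Y (List.mem_cons_of_mem X hY))

theorem HasCompactSupport.vIter {f : Pt → ℝ} (hf : HasCompactSupport f) :
    ∀ L : List (Pt → Pt), HasCompactSupport (vIter L f)
  | [] => hf
  | X :: L => (HasCompactSupport.vIter hf L).vApp X

theorem lintegral_lintegral_add {μ ν : Measure ℝ} [SFinite ν] {F : ℝ × ℝ → ENNReal}
    (hF : Measurable F) (G : ℝ × ℝ → ENNReal) :
    ∫⁻ u, ∫⁻ v, (F (u, v) + G (u, v)) ∂ν ∂μ =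
      ∫⁻ u, ∫⁻ v, F (u, v) ∂ν ∂μ + ∫⁻ u, ∫⁻ v, G (u, v) ∂ν ∂μ := by
  rw [← lintegral_add_left hF.lintegral_prod_right']
  exact lintegral_congr fun u => lintegral_add_left (hF.comp measurable_prodMk_left) _

/-- Sobolev embedding at a corner of a box: a bound on the box integrals of all `V^I f` with
`|I| ≤ 3` controls the value of `f` at the corner. -/
theorem ofReal_sq_le_of_lintegral_box_le {f : Pt → ℝ} (hf : ContDiff ℝ (⊤ : ℕ∞) f)
    (τ θ a b c : ℝ) {M : ENNReal}
    (hM : ∀ L : List (Pt → Pt),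
      (∀ X ∈ L, X ∈ [boostVF (axisPt a) 1, boostVF (axisPt a) 2, transVF 1]) → L.length ≤ 3 →
      ∫⁻ u in Set.Ioc (b - 1 / 20) b, ∫⁻ v in Set.Ioc (b - 1 / 20) b,
        ∫⁻ x in Set.Ioc (c - 1 / 20) c,
          ENNReal.ofReal (vIter L f (cartPt τ θ u v x) ^ 2) ≤ M) :
    ENNReal.ofReal (f (cartPt τ θ b b c) ^ 2) ≤ 63 * (63 * (42 * M)) := by
  set S := [boostVF (axisPt a) 1, boostVF (axisPt a) 2, transVF 1] with hS
  have hB1 : boostVF (axisPt a) 1 ∈ S := by simp [hS]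
  have hB2 : boostVF (axisPt a) 2 ∈ S := by simp [hS]
  have hT : transVF 1 ∈ S := by simp [hS]
  have hsm : ∀ {L : List (Pt → Pt)}, (∀ X ∈ L, X ∈ S) → ContDiff ℝ (⊤ : ℕ∞) (vIter L f) := by
    intro L hL
    refine contDiff_vIter hf fun X hX => ?_
    have := hL X hX
    simp only [hS, List.mem_cons, List.not_mem_nil, or_false] at this
    rcases this with rfl | rfl | rfl
    exacts [contDiff_boostVF _ _, contDiff_boostVF _ _, contDiff_transVF _]
  have hcons : ∀ {X : Pt → Pt} {L : List (Pt → Pt)}, X ∈ S → (∀ Y ∈ L, Y ∈ S) →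
      ∀ Y ∈ X :: L, Y ∈ S := fun hX hL Y hY =>
    (List.mem_cons.1 hY).elim (fun h => h ▸ hX) (hL Y)
  have hmeas : ∀ {L : List (Pt → Pt)}, (∀ X ∈ L, X ∈ S) → Measurable fun q : (ℝ × ℝ) × ℝ =>
      ENNReal.ofReal (vIter L f (cartPt τ θ q.1.1 q.1.2 q.2) ^ 2) := fun hL =>
    measurable_ofReal_sq_cartPt (hsm hL).continuous τ θ (by fun_prop) (by fun_prop) (by fun_prop)
  have hmeas2 : ∀ {L : List (Pt → Pt)}, (∀ X ∈ L, X ∈ S) → Measurable fun q : ℝ × ℝ =>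
      ENNReal.ofReal (vIter L f (cartPt τ θ q.1 q.2 c) ^ 2) := fun hL =>
    measurable_ofReal_sq_cartPt (hsm hL).continuous τ θ (by fun_prop) (by fun_prop) (by fun_prop)
  have hmeas1 : ∀ {L : List (Pt → Pt)}, (∀ X ∈ L, X ∈ S) → Measurable fun u : ℝ =>
      ENNReal.ofReal (vIter L f (cartPt τ θ u b c) ^ 2) := fun hL =>
    measurable_ofReal_sq_cartPt (hsm hL).continuous τ θ (by fun_prop) (by fun_prop) (by fun_prop)
  have step2 : ∀ L : List (Pt → Pt), (∀ X ∈ L, X ∈ S) → L.length ≤ 2 →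
      ∫⁻ u in Set.Ioc (b - 1 / 20) b, ∫⁻ v in Set.Ioc (b - 1 / 20) b,
        ENNReal.ofReal (vIter L f (cartPt τ θ u v c) ^ 2) ≤ 21 * (M + M) := by
    intro L hL hlen
    have hL' := hcons hT hL
    calc _ ≤ ∫⁻ u in Set.Ioc (b - 1 / 20) b, ∫⁻ v in Set.Ioc (b - 1 / 20) b,
          21 * ((∫⁻ x in Set.Ioc (c - 1 / 20) c,
            ENNReal.ofReal (vIter L f (cartPt τ θ u v x) ^ 2)) +
          ∫⁻ x in Set.Ioc (c - 1 / 20) c,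
            ENNReal.ofReal (vIter (transVF 1 :: L) f (cartPt τ θ u v x) ^ 2)) := by
          refine lintegral_mono fun u => lintegral_mono fun v => ?_
          refine (lintegral_cartPt_thd (hsm hL) τ θ u v c).trans_eq ?_
          simp only [ENNReal.ofReal_add (sq_nonneg _) (sq_nonneg _)]
          exact congrArg (21 * ·) (lintegral_add_left (measurable_ofReal_sq_cartPt
            (hsm hL).continuous τ θ measurable_const measurable_const measurable_id) _)
      _ = 21 * (_ + _) := by
          simp only [lintegral_const_mul' _ _ (ENNReal.ofNat_ne_top (n := 21))]
          rw [lintegral_lintegral_add (hmeas hL).lintegral_prod_right'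
            fun q => ∫⁻ x in Set.Ioc (c - 1 / 20) c,
              ENNReal.ofReal (vIter (transVF 1 :: L) f (cartPt τ θ q.1 q.2 x) ^ 2)]
      _ ≤ _ := by
          gcongr
          · exact hM L hL (by omega)
          · exact hM _ hL' (by simp; omega)
  have step1 : ∀ L : List (Pt → Pt), (∀ X ∈ L, X ∈ S) → L.length ≤ 1 →
      ∫⁻ u in Set.Ioc (b - 1 / 20) b, ENNReal.ofReal (vIter L f (cartPt τ θ u b c) ^ 2) ≤
        21 * (21 * (M + M) + 21 * (M + M) + 21 * (M + M)) := by
    intro L hL hlen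
    have hL1 := hcons hB1 hL
    have hL2 := hcons hB2 hL
    calc _ ≤ ∫⁻ u in Set.Ioc (b - 1 / 20) b, 21 * ∫⁻ v in Set.Ioc (b - 1 / 20) b,
          (ENNReal.ofReal (vIter L f (cartPt τ θ u v c) ^ 2) +
          ENNReal.ofReal (vIter (boostVF (axisPt a) 1 :: L) f (cartPt τ θ u v c) ^ 2) +
          ENNReal.ofReal (vIter (boostVF (axisPt a) 2 :: L) f (cartPt τ θ u v c) ^ 2)) := by
          refine lintegral_mono fun u => ?_
          refine (lintegral_cartPt_snd (hsm hL) τ θ a u c b).trans_eq ?_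
          simp only [ENNReal.ofReal_add (add_nonneg (sq_nonneg _) (sq_nonneg _)) (sq_nonneg _),
            ENNReal.ofReal_add (sq_nonneg _) (sq_nonneg _)]
          rfl
      _ = 21 * ((∫⁻ u in Set.Ioc (b - 1 / 20) b, ∫⁻ v in Set.Ioc (b - 1 / 20) b,
            ENNReal.ofReal (vIter L f (cartPt τ θ u v c) ^ 2)) +
          (∫⁻ u in Set.Ioc (b - 1 / 20) b, ∫⁻ v in Set.Ioc (b - 1 / 20) b,
            ENNReal.ofReal (vIter (boostVF (axisPt a) 1 :: L) f (cartPt τ θ u v c) ^ 2)) +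
          ∫⁻ u in Set.Ioc (b - 1 / 20) b, ∫⁻ v in Set.Ioc (b - 1 / 20) b,
            ENNReal.ofReal (vIter (boostVF (axisPt a) 2 :: L) f (cartPt τ θ u v c) ^ 2)) := by
          have hadd : Measurable fun q : ℝ × ℝ =>
              ENNReal.ofReal (vIter L f (cartPt τ θ q.1 q.2 c) ^ 2) +
              ENNReal.ofReal (vIter (boostVF (axisPt a) 1 :: L) f (cartPt τ θ q.1 q.2 c) ^ 2) :=
            (hmeas2 hL).add (hmeas2 hL1)
          rw [lintegral_const_mul' _ _ (by simp)]
          congr 1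
          refine (lintegral_lintegral_add hadd fun q => ENNReal.ofReal
            (vIter (boostVF (axisPt a) 2 :: L) f (cartPt τ θ q.1 q.2 c) ^ 2)).trans ?_
          congr 1
          exact lintegral_lintegral_add (hmeas2 hL) fun q => ENNReal.ofReal
            (vIter (boostVF (axisPt a) 1 :: L) f (cartPt τ θ q.1 q.2 c) ^ 2)
      _ ≤ _ := by
          gcongr
          · exact step2 L hL (by omega)
          · exact step2 _ hL1 (by simp; omega)
          · exact step2 _ hL2 (by simp; omega)
  have hnil : ∀ X ∈ ([] : List (Pt → Pt)), X ∈ S := by simp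
  have hL1 := hcons hB1 hnil
  have hL2 := hcons hB2 hnil
  calc _ ≤ _ := lintegral_cartPt_fst hf τ θ a b c b
    _ = 21 * ((∫⁻ u in Set.Ioc (b - 1 / 20) b,
          ENNReal.ofReal (vIter [] f (cartPt τ θ u b c) ^ 2)) +
        (∫⁻ u in Set.Ioc (b - 1 / 20) b,
          ENNReal.ofReal (vIter [boostVF (axisPt a) 1] f (cartPt τ θ u b c) ^ 2)) +
        ∫⁻ u in Set.Ioc (b - 1 / 20) b,
          ENNReal.ofReal (vIter [boostVF (axisPt a) 2] f (cartPt τ θ u b c) ^ 2)) := by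
        have hadd : Measurable fun u : ℝ => ENNReal.ofReal (vIter [] f (cartPt τ θ u b c) ^ 2) +
            ENNReal.ofReal (vIter [boostVF (axisPt a) 1] f (cartPt τ θ u b c) ^ 2) :=
          (hmeas1 hnil).add (hmeas1 hL1)
        simp only [ENNReal.ofReal_add (add_nonneg (sq_nonneg _) (sq_nonneg _)) (sq_nonneg _),
          ENNReal.ofReal_add (sq_nonneg _) (sq_nonneg _)]
        congr 1
        refine (lintegral_add_left hadd _).trans ?_
        congr 1
        exact lintegral_add_left (hmeas1 hnil) _
    _ ≤ 21 * (21 * (21 * (M + M) + 21 * (M + M) + 21 * (M + M)) +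
          21 * (21 * (M + M) + 21 * (M + M) + 21 * (M + M)) +
          21 * (21 * (M + M) + 21 * (M + M) + 21 * (M + M))) := by
        gcongr
        · exact step1 _ hnil (by simp)
        · exact step1 _ hL1 (by simp)
        · exact step1 _ hL2 (by simp)
    _ = _ := by ring

theorem exists_ofFn_map_get_eq {A : Type*} (Γ : List A) (L : List A) (hL : ∀ X ∈ L, X ∈ Γ) :
    ∃ I : Fin L.length → Fin Γ.length, (List.ofFn I).map Γ.get = L := by
  choose I hI using fun i : Fin L.length => List.mem_iff_get.1 (hL (L.get i) (L.get_mem i))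
  refine ⟨I, ?_⟩
  rw [List.map_ofFn, show Γ.get ∘ I = L.get from funext hI, List.ofFn_get]

theorem hypL2_nonneg (f : Pt → ℝ) (τ : ℝ) : 0 ≤ hypL2 f τ := Real.sqrt_nonneg _

theorem hypL2_le_sum (Γ : List (Pt → Pt)) (f : Pt → ℝ) (τ : ℝ) {L : List (Pt → Pt)} {n : ℕ}
    (hL : ∀ X ∈ L, X ∈ Γ) (hn : L.length < n) :
    hypL2 (vIter L f) τ ≤ ∑ k ∈ Finset.range n, ∑ I : Fin k → Fin Γ.length,
      hypL2 (vIter ((List.ofFn I).map Γ.get) f) τ := by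
  obtain ⟨I, hI⟩ := exists_ofFn_map_get_eq Γ L hL
  calc hypL2 (vIter L f) τ = hypL2 (vIter ((List.ofFn I).map Γ.get) f) τ := by rw [hI]
    _ ≤ ∑ I : Fin L.length → Fin Γ.length, hypL2 (vIter ((List.ofFn I).map Γ.get) f) τ :=
      Finset.single_le_sum (f := fun I => hypL2 (vIter ((List.ofFn I).map Γ.get) f) τ)
        (fun _ _ => hypL2_nonneg _ _) (Finset.mem_univ I)
    _ ≤ _ := Finset.single_le_sum (f := fun k => ∑ I : Fin k → Fin Γ.length,
        hypL2 (vIter ((List.ofFn I).map Γ.get) f) τ)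
        (fun _ _ => Finset.sum_nonneg fun _ _ => hypL2_nonneg _ _) (Finset.mem_range.2 hn)

theorem exists_eq_cartPt {p : Pt} {τ : ℝ} (hp : 0 ≤ p 0) (hτ : 0 < τ)
    (hτp : τ ^ 2 = p 0 ^ 2 - p 2 ^ 2 - p 3 ^ 2) (hcone : p 2 ^ 2 + p 3 ^ 2 ≤ p 0 ^ 2 / 100) :
    ∃ θ b : ℝ, 0 ≤ b ∧ b ^ 2 ≤ 1 / 198 ∧ p = cartPt τ θ b b (p 1) := by
  set ζ : ℂ := ⟨p 2, p 3⟩ with hζ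
  have hy : p 2 = ‖ζ‖ * Real.cos ζ.arg := (Complex.norm_mul_cos_arg ζ).symm
  have hz : p 3 = ‖ζ‖ * Real.sin ζ.arg := (Complex.norm_mul_sin_arg ζ).symm
  have hsq : ‖ζ‖ ^ 2 = p 2 ^ 2 + p 3 ^ 2 := by
    rw [Complex.sq_norm, Complex.normSq_apply]
    ring
  have h2 : √2 ^ 2 = (2 : ℝ) := Real.sq_sqrt (by norm_num)
  have hb2 : (‖ζ‖ * √2 / (2 * τ)) ^ 2 = (p 2 ^ 2 + p 3 ^ 2) / (2 * τ ^ 2) := by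
    rw [div_pow, mul_pow, mul_pow, h2, hsq]
    field_simp
  refine ⟨ζ.arg - Real.pi / 4, ‖ζ‖ * √2 / (2 * τ), by positivity, ?_, ?_⟩
  · rw [hb2, div_le_div_iff₀ (by positivity) (by norm_num)]
    linarith
  · have h0 : τ * √(1 + (‖ζ‖ * √2 / (2 * τ)) ^ 2 + (‖ζ‖ * √2 / (2 * τ)) ^ 2) = p 0 := by
      rw [hb2, show 1 + (p 2 ^ 2 + p 3 ^ 2) / (2 * τ ^ 2) + (p 2 ^ 2 + p 3 ^ 2) / (2 * τ ^ 2) =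
        (p 0 / τ) ^ 2 by field_simp; linarith, Real.sqrt_sq (by positivity)]
      field_simp
    ext i
    fin_cases i
    · exact h0.symm
    · rfl
    · change p 2 = τ * _
      rw [Real.cos_sub, Real.sin_sub, Real.cos_pi_div_four, Real.sin_pi_div_four, hy]
      field_simp
      linear_combination (-2 * ‖ζ‖ * Real.cos ζ.arg) * h2
    · change p 3 = τ * _
      rw [Real.cos_sub, Real.sin_sub, Real.cos_pi_div_four, Real.sin_pi_div_four, hz]
      field_simp
      linear_combination (-2 * ‖ζ‖ * Real.sin ζ.arg) * h2

/-- Lemma 6.2, Sobolev inequality on hyperboloids: for `t ≥ 1` and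
`ρ = √(y²+z²) ≤ t/10`, with `τ = √(t² − ρ²)`,
`|f| ≤ (C/t) Σ_{|I| ≤ 3} ‖V^I f‖_{L²(H_τ ∩ {ρ ≤ t/10})}`, the fields ranging over `Γ^{(a)}`. -/
theorem hyperboloid_sobolev :
    ∃ C > (0 : ℝ), ∀ R : ℝ, 1 ≤ R → ∀ a : ℝ, ∀ f : Pt → ℝ,
      ContDiff ℝ (⊤ : ℕ∞) f → HasCompactSupport f →
      ∀ p : Pt, 1 ≤ p 0 → Real.sqrt (p 2 ^ 2 + p 3 ^ 2) ≤ p 0 / 10 →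
        |f p| ≤ C / p 0 *
          ∑ k ∈ Finset.range 4, ∑ I : Fin k → Fin (GammaFields R a).length,
            hypL2 (vIter ((List.ofFn I).map (GammaFields R a).get) f)
              (Real.sqrt (p 0 ^ 2 - p 2 ^ 2 - p 3 ^ 2)) := by
  refine ⟨1000, by norm_num, fun R _ a f hf hfs p hp hcone => ?_⟩
  set τ := √(p 0 ^ 2 - p 2 ^ 2 - p 3 ^ 2) with hτdef
  have hcone' : p 2 ^ 2 + p 3 ^ 2 ≤ p 0 ^ 2 / 100 := by
    have := (Real.sqrt_le_left (by positivity)).1 hcone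
    linarith
  have hp0 : 0 < p 0 := by linarith
  have hτsq : τ ^ 2 = p 0 ^ 2 - p 2 ^ 2 - p 3 ^ 2 := Real.sq_sqrt (by nlinarith)
  have hτ : 0 < τ := Real.sqrt_pos.2 (by nlinarith)
  obtain ⟨θ, b, hb, hb', hpt⟩ := exists_eq_cartPt hp0.le hτ hτsq hcone'
  set S := ∑ k ∈ Finset.range 4, ∑ I : Fin k → Fin (GammaFields R a).length,
    hypL2 (vIter ((List.ofFn I).map (GammaFields R a).get) f) τ with hSdef
  have hS : 0 ≤ S := Finset.sum_nonneg fun _ _ => Finset.sum_nonneg fun _ _ => hypL2_nonneg _ _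
  have hbound := ofReal_sq_le_of_lintegral_box_le hf τ θ a b (p 1)
    (M := ENNReal.ofReal (2 / τ ^ 2 * S ^ 2)) fun L hL hlen => by
      have hmem : ∀ X ∈ L, X ∈ GammaFields R a := fun X hX => by
        have := hL X hX
        simp only [List.mem_cons, List.not_mem_nil, or_false] at this
        rcases this with rfl | rfl | rfl <;> simp [GammaFields]
      have hle := hypL2_le_sum (GammaFields R a) f τ hmem (Nat.lt_succ_of_le hlen)
      have hsm : ContDiff ℝ (⊤ : ℕ∞) (vIter L f) := contDiff_vIter hf fun X hX => by
        have := hL X hX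
        simp only [List.mem_cons, List.not_mem_nil, or_false] at this
        rcases this with rfl | rfl | rfl
        exacts [contDiff_boostVF _ _, contDiff_boostVF _ _, contDiff_transVF _]
      have hbox := lintegral_box_le_hypL2 hsm.continuous (hfs.vIter L) hτ θ (p 1) hb hb'
      rw [show 2 / τ ^ 2 * S ^ 2 = 2 * S ^ 2 / τ ^ 2 by ring,
        ENNReal.ofReal_div_of_pos (by positivity), ENNReal.le_div_iff_mul_le (by simp [hτ.ne'])
          (by simp), mul_comm]
      refine hbox.trans ?_
      rw [ENNReal.ofReal_mul (by norm_num), ENNReal.ofReal_ofNat]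
      gcongr
      exact hypL2_nonneg _ _
  rw [← hpt, show ∀ M : ENNReal, 63 * (63 * (42 * M)) = ENNReal.ofReal 166698 * M from fun M => by
    rw [show (166698 : ℝ) = 63 * (63 * 42) by norm_num, ENNReal.ofReal_mul (by norm_num),
      ENNReal.ofReal_mul (by norm_num)]
    simp [mul_assoc],
    ← ENNReal.ofReal_mul (by norm_num), ENNReal.ofReal_le_ofReal_iff (by positivity)] at hbound
  refine abs_le_of_sq_le_sq ?_ (by positivity)
  refine hbound.trans ?_
  have hτp : p 0 ^ 2 * (99 / 100) ≤ τ ^ 2 := by linarith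
  rw [show (1000 / p 0 * S) ^ 2 = 1000000 / p 0 ^ 2 * S ^ 2 by ring, ← mul_assoc]
  gcongr ?_ * S ^ 2
  rw [mul_div_assoc', div_le_div_iff₀ (by positivity) (by positivity)]
  nlinarith

end
end

section
/- There exists a constant C > 0 such that the following holds for every R ≥ 1. Let f : ℝ^{1+3} → ℝ be smooth and compactly supported in the spatial variables at each time. Then for every (t,x,y,z) ∈ ℝ^{1+3}, with r = √(x²+y²+z²): |f(t,x,y,z)|² ≤ C (R² / (1+r)²) · Σ_{I, |I| ≤ 3} ‖V^I f‖²_{L²(Σ_t)}, where the sum runs over all lists I of at most 3 vector fields from K_R. -/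
open MeasureTheory

noncomputable section

/-- The spatial translations and the rotations about the origin rescaled by `R⁻¹`. -/
def spatialField (R : ℝ) : Fin 6 → Sp → Sp :=
  ![fun _ => ![1, 0, 0], fun _ => ![0, 1, 0], fun _ => ![0, 0, 1],
    fun x => R⁻¹ • ![-x 1, x 0, 0], fun x => R⁻¹ • ![-x 2, 0, x 0],
    fun x => R⁻¹ • ![0, -x 2, x 1]]

/-- Apply a field of `spatialField R`, or do nothing. -/
def optApp (R : ℝ) : Option (Fin 6) → (Sp → ℝ) → Sp → ℝ
  | none, g => g
  | some v, g => svApp (spatialField R v) g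

/-- Sum of the squares of all derivatives of order one along `spatialField R`. -/
def gradSq (R : ℝ) (g : Sp → ℝ) (x : Sp) : ℝ := ∑ v, (svApp (spatialField R v) g x) ^ 2

/-- Sum of the squares of the derivatives of order at most `n` along `spatialField R`,
with multiplicity. -/
def energy (R : ℝ) : ℕ → (Sp → ℝ) → Sp → ENNReal
  | 0, g => fun x => ENNReal.ofReal ((g x) ^ 2)
  | n + 1, g => fun x => ∑ o, energy R n (optApp R o g) x

/-- Smooth functions of compact support on `ℝ³`. -/
def IsTest (g : Sp → ℝ) : Prop := ContDiff ℝ (⊤ : ℕ∞) g ∧ HasCompactSupport g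

lemma contDiff_spatialField (R : ℝ) (v : Fin 6) :
    ContDiff ℝ (⊤ : ℕ∞) (spatialField R v) := by
  rw [contDiff_pi]
  intro i
  fin_cases v <;> fin_cases i <;> simp [spatialField] <;> fun_prop

lemma IsTest.optApp {g : Sp → ℝ} (hg : IsTest g) (R : ℝ) (o : Option (Fin 6)) :
    IsTest (optApp R o g) := by
  cases o with
  | none => exact hg
  | some v =>
    refine ⟨?_, ?_⟩
    · exact (hg.1.fderiv_right (m := (⊤ : ℕ∞)) (by simp)).clm_apply (contDiff_spatialField R v)
    · refine (hg.2.fderiv ℝ).mono fun x hx => ?_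
      simp only [Function.mem_support] at hx ⊢
      intro h
      exact hx (by simp [_root_.optApp, svApp, h])

lemma IsTest.differentiable {g : Sp → ℝ} (hg : IsTest g) : Differentiable ℝ g :=
  hg.1.differentiable (by simp)

lemma IsTest.exists_bound {g : Sp → ℝ} (hg : IsTest g) : ∃ M : ℝ, ∀ x, M < ‖x‖ → g x = 0 := by
  obtain ⟨M, hM⟩ := hg.2.isCompact.isBounded.exists_norm_le
  refine ⟨M, fun x hx => ?_⟩
  by_contra h
  exact absurd (hM x (subset_tsupport _ h)) (not_le.2 hx)

lemma IsTest.continuous_energy {g : Sp → ℝ} (hg : IsTest g) (R : ℝ) (n : ℕ) :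
    Continuous (energy R n g) := by
  induction n generalizing g with
  | zero =>
    exact ENNReal.continuous_ofReal.comp (hg.1.continuous.pow 2)
  | succ n ih =>
    unfold energy
    exact continuous_finsetSum _ fun o _ => ih (hg.optApp R o)

lemma energy_one (R : ℝ) (g : Sp → ℝ) (x : Sp) :
    energy R 1 g x = ENNReal.ofReal ((g x) ^ 2 + gradSq R g x) := by
  rw [gradSq]
  simp only [energy]
  rw [← ENNReal.ofReal_sum_of_nonneg fun _ _ => sq_nonneg _, Fintype.sum_option]
  rfl

lemma gradSq_nonneg (R : ℝ) (g : Sp → ℝ) (x : Sp) : 0 ≤ gradSq R g x :=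
  Finset.sum_nonneg fun _ _ => sq_nonneg _

/-- An estimate of a function at a point by the first-order energy along a curve is inherited by
the energies of higher order. -/
lemma mul_energy_le {R : ℝ} {x₀ : Sp} {γ : ℝ → Sp} (hγ : Continuous γ) {S : Set ℝ}
    {w c : ENNReal} {p : ℝ → ENNReal} (hp : Measurable p)
    (h : ∀ g, IsTest g → w * energy R 0 g x₀ ≤ c * ∫⁻ τ in S, p τ * energy R 1 g (γ τ))
    (n : ℕ) {g : Sp → ℝ} (hg : IsTest g) :
    w * energy R n g x₀ ≤ c * ∫⁻ τ in S, p τ * energy R (n + 1) g (γ τ) := by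
  induction n generalizing g with
  | zero => exact h g hg
  | succ n ih =>
    have e1 : energy R (n + 1) g x₀ = ∑ o, energy R n (optApp R o g) x₀ := rfl
    have e2 : ∀ x, energy R (n + 1 + 1) g x = ∑ o, energy R (n + 1) (optApp R o g) x :=
      fun _ => rfl
    have e3 : ∫⁻ τ in S, ∑ o, p τ * energy R (n + 1) (optApp R o g) (γ τ) =
        ∑ o, ∫⁻ τ in S, p τ * energy R (n + 1) (optApp R o g) (γ τ) :=
      lintegral_finsetSum _ fun o _ => hp.mul
        (((hg.optApp R o).continuous_energy R (n + 1)).comp hγ).measurable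
    simp only [e1, e2, Finset.mul_sum]
    rw [e3, Finset.mul_sum]
    exact Finset.sum_le_sum fun o _ => ih (hg.optApp R o)

lemma ofReal_le_setLIntegral {F F' G : ℝ → ℝ} (hF : ∀ τ, HasDerivAt F (F' τ) τ)
    (hc : Continuous F') {a b : ℝ} (ha : F a = 0) {S : Set ℝ} (hS : MeasurableSet S)
    (hab : Set.uIoc a b ⊆ S) (hG : ∀ τ ∈ S, |F' τ| ≤ G τ) :
    ENNReal.ofReal (F b) ≤ ∫⁻ τ in S, ENNReal.ofReal (G τ) := by
  have h1 : ∫ τ in a..b, F' τ = F b := by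
    rw [intervalIntegral.integral_eq_sub_of_hasDerivAt (fun τ _ => hF τ)
      (hc.intervalIntegrable _ _), ha, sub_zero]
  calc ENNReal.ofReal (F b) ≤ ENNReal.ofReal ‖∫ τ in Set.uIoc a b, F' τ‖ := by
        rw [← intervalIntegral.norm_intervalIntegral_eq, h1]
        exact ENNReal.ofReal_le_ofReal (le_abs_self _)
    _ = ‖∫ τ in Set.uIoc a b, F' τ‖ₑ := ofReal_norm _
    _ ≤ ∫⁻ τ in Set.uIoc a b, ‖F' τ‖ₑ := enorm_integral_le_lintegral_enorm _
    _ ≤ ∫⁻ τ in S, ‖F' τ‖ₑ := lintegral_mono_set hab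
    _ ≤ ∫⁻ τ in S, ENNReal.ofReal (G τ) := by
        refine setLIntegral_mono' hS fun τ hτ => ?_
        rw [← ofReal_norm]
        exact ENNReal.ofReal_le_ofReal (hG τ hτ)

lemma sq_svApp_le (R : ℝ) (g : Sp → ℝ) (x : Sp) (v : Fin 6) :
    (fderiv ℝ g x (spatialField R v x)) ^ 2 ≤ gradSq R g x :=
  Finset.single_le_sum (f := fun v => (svApp (spatialField R v) g x) ^ 2)
    (fun _ _ => sq_nonneg _) (Finset.mem_univ v)

lemma sq_fderiv_single_le (R : ℝ) (g : Sp → ℝ) (x : Sp) (i : Fin 3) :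
    (fderiv ℝ g x (Pi.single i 1)) ^ 2 ≤ gradSq R g x := by
  convert sq_svApp_le R g x ⟨i, by omega⟩ using 3
  ext j
  fin_cases i <;> fin_cases j <;> simp [spatialField]

lemma sq_fderiv_unit_le (R : ℝ) (g : Sp → ℝ) (x y : Sp)
    (hy : (y 0) ^ 2 + (y 1) ^ 2 + (y 2) ^ 2 = 1) :
    (fderiv ℝ g x y) ^ 2 ≤ gradSq R g x := by
  set a := fun v => fderiv ℝ g x (spatialField R v x) with ha
  have e : fderiv ℝ g x y = y 0 * a 0 + y 1 * a 1 + y 2 * a 2 := by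
    have : y = y 0 • spatialField R 0 x + y 1 • spatialField R 1 x + y 2 • spatialField R 2 x := by
      ext j
      fin_cases j <;> simp [spatialField]
    conv_lhs => rw [this]
    simp [ha]
  have h : (a 0) ^ 2 + (a 1) ^ 2 + (a 2) ^ 2 ≤ gradSq R g x := by
    have : gradSq R g x = ∑ v, (a v) ^ 2 := rfl
    rw [this, Fin.sum_univ_six]
    nlinarith [sq_nonneg (a 3), sq_nonneg (a 4), sq_nonneg (a 5)]
  rw [e]
  refine le_trans ?_ h
  have : (y 0 * a 0 + y 1 * a 1 + y 2 * a 2) ^ 2 =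
      ((y 0) ^ 2 + (y 1) ^ 2 + (y 2) ^ 2) * ((a 0) ^ 2 + (a 1) ^ 2 + (a 2) ^ 2)
      - (y 0 * a 1 - y 1 * a 0) ^ 2 - (y 0 * a 2 - y 2 * a 0) ^ 2
      - (y 1 * a 2 - y 2 * a 1) ^ 2 := by ring
  rw [this, hy]
  nlinarith [sq_nonneg (y 0 * a 1 - y 1 * a 0), sq_nonneg (y 0 * a 2 - y 2 * a 0),
    sq_nonneg (y 1 * a 2 - y 2 * a 1)]

lemma energy_le_line (R : ℝ) {g : Sp → ℝ} (hg : IsTest g) (x : Sp) (i : Fin 3) :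
    energy R 0 g x ≤ ∫⁻ τ, energy R 1 g (Function.update x i τ) := by
  obtain ⟨M, hM⟩ := hg.exists_bound
  set a := |M| + 1 with ha
  have hc1 : Continuous fun τ : ℝ => Function.update x i τ := continuous_const.update i continuous_id
  have hfd : Continuous (fderiv ℝ g) := hg.1.continuous_fderiv (by simp)
  have hgc : Continuous g := hg.1.continuous
  have hd : ∀ τ, HasDerivAt (fun τ => g (Function.update x i τ))
      (fderiv ℝ g (Function.update x i τ) (Pi.single i 1)) τ := fun τ =>
    (hg.differentiable _).hasFDerivAt.comp_hasDerivAt τ (hasDerivAt_update x i τ)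
  have key := ofReal_le_setLIntegral (F := fun τ => (g (Function.update x i τ)) ^ 2)
    (G := fun τ => (g (Function.update x i τ)) ^ 2 + gradSq R g (Function.update x i τ))
    (fun τ => (hd τ).pow 2) (by fun_prop) (a := a) (b := x i) (S := Set.univ) ?_
    MeasurableSet.univ (Set.subset_univ _) ?_
  · change ENNReal.ofReal _ ≤ _
    simpa only [Function.update_eq_self, Measure.restrict_univ, ← energy_one] using key
  · have : g (Function.update x i a) = 0 := by
      refine hM _ (lt_of_lt_of_le ?_ (norm_le_pi_norm _ i))
      rw [Function.update_self, Real.norm_eq_abs]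
      exact lt_of_lt_of_le (by rw [ha]; linarith [le_abs_self M]) (le_abs_self a)
    simp [this]
  · intro τ _
    have h := sq_fderiv_single_le R g (Function.update x i τ) i
    set A := g (Function.update x i τ)
    set B := fderiv ℝ g (Function.update x i τ) (Pi.single i 1)
    rw [abs_le]
    norm_num only [Nat.cast_ofNat, pow_one]
    constructor <;> nlinarith [sq_nonneg (A + B), sq_nonneg (A - B)]

/-- The point of `ℝ³` with coordinates `u, v, w` along the coordinate axes cyclically shifted
by `m`. -/
def shiftPt (m : Fin 3) (u v w : ℝ) : Sp := fun i => ![u, v, w] (i - m)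

/-- Spherical coordinates whose polar axis is the `m`-th coordinate axis. -/
def polarPt (m : Fin 3) (s θ φ : ℝ) : Sp :=
  shiftPt m (s * Real.cos θ) (s * (Real.sin θ * Real.cos φ)) (s * (Real.sin θ * Real.sin φ))

lemma hasDerivAt_shiftPt (m : Fin 3) {u v w : ℝ → ℝ} {u' v' w' τ : ℝ} (hu : HasDerivAt u u' τ)
    (hv : HasDerivAt v v' τ) (hw : HasDerivAt w w' τ) :
    HasDerivAt (fun τ => shiftPt m (u τ) (v τ) (w τ)) (shiftPt m u' v' w') τ := by
  rw [hasDerivAt_pi]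
  intro i
  unfold shiftPt
  generalize i - m = j
  fin_cases j <;> simpa

lemma continuous_shiftPt (m : Fin 3) :
    Continuous fun p : ℝ × ℝ × ℝ => shiftPt m p.1 p.2.1 p.2.2 := by
  refine continuous_pi fun i => ?_
  unfold shiftPt
  generalize i - m = j
  fin_cases j <;> simp <;> fun_prop

lemma continuous_polarPt (m : Fin 3) :
    Continuous fun p : ℝ × ℝ × ℝ => polarPt m p.1 p.2.1 p.2.2 := by
  have := (continuous_shiftPt m).comp (show Continuous fun p : ℝ × ℝ × ℝ =>
    (p.1 * Real.cos p.2.1, p.1 * (Real.sin p.2.1 * Real.cos p.2.2),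
      p.1 * (Real.sin p.2.1 * Real.sin p.2.2)) by fun_prop)
  exact this

lemma hasDerivAt_polarPt_azimuth (m : Fin 3) (s θ φ : ℝ) :
    HasDerivAt (fun φ => polarPt m s θ φ)
      (shiftPt m 0 (-(s * (Real.sin θ * Real.sin φ))) (s * (Real.sin θ * Real.cos φ))) φ := by
  refine hasDerivAt_shiftPt m (hasDerivAt_const _ _) ?_ ?_
  · simpa using (((Real.hasDerivAt_cos φ).const_mul (Real.sin θ)).const_mul s)
  · exact (((Real.hasDerivAt_sin φ).const_mul (Real.sin θ)).const_mul s)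

lemma hasDerivAt_polarPt_polar (m : Fin 3) (s θ φ : ℝ) :
    HasDerivAt (fun θ => polarPt m s θ φ)
      (shiftPt m (-(s * Real.sin θ)) (s * (Real.cos θ * Real.cos φ))
        (s * (Real.cos θ * Real.sin φ))) θ := by
  refine hasDerivAt_shiftPt m ?_ ?_ ?_
  · simpa using (Real.hasDerivAt_cos θ).const_mul s
  · exact (((Real.hasDerivAt_sin θ).mul_const (Real.cos φ)).const_mul s)
  · exact (((Real.hasDerivAt_sin θ).mul_const (Real.sin φ)).const_mul s)

lemma hasDerivAt_polarPt_radial (m : Fin 3) (s θ φ : ℝ) :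
    HasDerivAt (fun s => polarPt m s θ φ) (polarPt m 1 θ φ) s := by
  refine hasDerivAt_shiftPt m ?_ ?_ ?_
  all_goals exact (hasDerivAt_id s).mul_const _

lemma sq_fderiv_azimuth_le {R : ℝ} (hR : R ≠ 0) (g : Sp → ℝ) (m : Fin 3) (u v w : ℝ) :
    (fderiv ℝ g (shiftPt m u v w) (shiftPt m 0 (-w) v)) ^ 2 ≤
      2 * R ^ 2 * gradSq R g (shiftPt m u v w) := by
  obtain ⟨k, c, hc, h⟩ : ∃ (k : Fin 6) (c : ℝ), c ^ 2 = R ^ 2 ∧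
      shiftPt m 0 (-w) v = c • spatialField R k (shiftPt m u v w) := by
    refine ⟨![5, 4, 3] m, ![R, -R, R] m, ?_, ?_⟩
    · fin_cases m <;> simp
    · ext i
      fin_cases m <;> fin_cases i <;> simp [shiftPt, spatialField, hR]
  rw [h, map_smul, smul_eq_mul, mul_pow, hc]
  nlinarith [mul_le_mul_of_nonneg_left (sq_svApp_le R g (shiftPt m u v w) k) (sq_nonneg R),
    mul_nonneg (sq_nonneg R) (gradSq_nonneg R g (shiftPt m u v w))]

lemma sq_fderiv_polar_le {R : ℝ} (hR : R ≠ 0) (g : Sp → ℝ) (m : Fin 3) (u ρ φ : ℝ) :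
    (fderiv ℝ g (shiftPt m u (ρ * Real.cos φ) (ρ * Real.sin φ))
      (shiftPt m (-ρ) (u * Real.cos φ) (u * Real.sin φ))) ^ 2 ≤
      2 * R ^ 2 * gradSq R g (shiftPt m u (ρ * Real.cos φ) (ρ * Real.sin φ)) := by
  set x := shiftPt m u (ρ * Real.cos φ) (ρ * Real.sin φ) with hx
  have hcs := Real.sin_sq_add_cos_sq φ
  obtain ⟨k, l, c, d, hc, h⟩ : ∃ (k l : Fin 6) (c d : ℝ), c ^ 2 + d ^ 2 = R ^ 2 ∧
      shiftPt m (-ρ) (u * Real.cos φ) (u * Real.sin φ) =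
        c • spatialField R k x + d • spatialField R l x := by
    refine ⟨![3, 5, 4] m, ![4, 3, 5] m, ![R, R, -R] m * Real.cos φ, ![R, -R, -R] m * Real.sin φ,
      ?_, ?_⟩
    · fin_cases m <;> simp <;> linear_combination R ^ 2 * hcs
    · ext i
      fin_cases m <;> fin_cases i <;> simp [hx, shiftPt, spatialField] <;> field_simp <;>
        linear_combination ρ * hcs
  have h1 := sq_svApp_le R g x k
  have h2 := sq_svApp_le R g x l
  rw [h, map_add, map_smul, map_smul, smul_eq_mul, smul_eq_mul, ← hc]
  set a := fderiv ℝ g x (spatialField R k x)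
  set b := fderiv ℝ g x (spatialField R l x)
  nlinarith [sq_nonneg (c * b - d * a), mul_le_mul_of_nonneg_left h1 (sq_nonneg c),
    mul_le_mul_of_nonneg_left h1 (sq_nonneg d), mul_le_mul_of_nonneg_left h2 (sq_nonneg c),
    mul_le_mul_of_nonneg_left h2 (sq_nonneg d)]

lemma two_mul_abs_mul_le {R A B Q : ℝ} (hR : 1 ≤ R) (hQ : 0 ≤ Q) (h : B ^ 2 ≤ 2 * R ^ 2 * Q) :
    2 * A ^ 2 + 2 * |A * B| ≤ 3 * R * (A ^ 2 + Q) := by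
  have h0 : 0 < R := by linarith
  have h1 : 2 * |A * B| ≤ R * A ^ 2 + 2 * R * Q := by
    refine le_of_mul_le_mul_left ?_ h0
    rw [abs_mul]
    have := sq_nonneg (R * |A| - |B|)
    nlinarith [sq_abs A, sq_abs B]
  nlinarith [mul_nonneg h0.le hQ, mul_nonneg (sub_nonneg.2 hR) (sq_nonneg A)]

lemma abs_weighted_deriv_le {σ c A B : ℝ} (hσ : |σ| ≤ 1) (hc : |c| ≤ 1) :
    |(((2 : ℕ) : ℝ) * σ ^ (2 - 1) * c) * A ^ 2 + σ ^ 2 * (((2 : ℕ) : ℝ) * A ^ (2 - 1) * B)| ≤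
      |σ| * (2 * A ^ 2 + 2 * |A * B|) := by
  have h1 : |σ * (c * (2 * A ^ 2))| ≤ |σ| * (2 * A ^ 2) := by
    rw [abs_mul, abs_mul, abs_of_nonneg (by positivity : 0 ≤ 2 * A ^ 2)]
    exact mul_le_mul_of_nonneg_left (mul_le_of_le_one_left (by positivity) hc) (abs_nonneg _)
  have h2 : |σ * (σ * (2 * (A * B)))| ≤ |σ| * (2 * |A * B|) := by
    rw [abs_mul, abs_mul, abs_mul 2, abs_two]
    exact mul_le_mul_of_nonneg_left (mul_le_of_le_one_left (by positivity) hσ) (abs_nonneg _)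
  calc _ = |σ * (c * (2 * A ^ 2)) + σ * (σ * (2 * (A * B)))| := by norm_num; ring_nf
    _ ≤ _ := (abs_add_le _ _).trans (by linarith)

lemma energy_zero (R : ℝ) (g : Sp → ℝ) (x : Sp) :
    energy R 0 g x = ENNReal.ofReal ((g x) ^ 2) := rfl

lemma energy_le_azimuth {R : ℝ} (hR : 1 ≤ R) {g : Sp → ℝ} (hg : IsTest g) (m : Fin 3)
    (s θ : ℝ) {φ₀ : ℝ} (hφ : φ₀ ∈ Set.Ioo (-Real.pi) Real.pi) :
    ENNReal.ofReal (Real.sin φ₀ ^ 2) * energy R 0 g (polarPt m s θ φ₀) ≤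
      ENNReal.ofReal (3 * R) *
        ∫⁻ φ in Set.Ioo (-Real.pi) Real.pi, energy R 1 g (polarPt m s θ φ) := by
  have hc1 : Continuous fun φ => polarPt m s θ φ :=
    (continuous_polarPt m).comp (f := fun φ : ℝ => (s, θ, φ)) (by fun_prop)
  have hc2 : Continuous fun φ =>
      shiftPt m 0 (-(s * (Real.sin θ * Real.sin φ))) (s * (Real.sin θ * Real.cos φ)) :=
    (continuous_shiftPt m).comp (f := fun φ : ℝ => (0, -(s * (Real.sin θ * Real.sin φ)),
      (s * (Real.sin θ * Real.cos φ)))) (by fun_prop)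
  have hfd : Continuous (fderiv ℝ g) := hg.1.continuous_fderiv (by simp)
  have hgc : Continuous g := hg.1.continuous
  have hd := fun φ => (hg.differentiable _).hasFDerivAt.comp_hasDerivAt φ
    (hasDerivAt_polarPt_azimuth m s θ φ)
  have key := ofReal_le_setLIntegral (F := fun φ => Real.sin φ ^ 2 * (g (polarPt m s θ φ)) ^ 2)
    (G := fun φ => 3 * R * ((g (polarPt m s θ φ)) ^ 2 + gradSq R g (polarPt m s θ φ)))
    (fun φ => ((Real.hasDerivAt_sin φ).pow 2).mul ((hd φ).pow 2))
    (by simp only [Function.comp_def]; fun_prop) (a := 0) (b := φ₀)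
    (S := Set.Ioo (-Real.pi) Real.pi) (by simp) measurableSet_Ioo ?_ ?_
  · rw [← lintegral_const_mul' _ _ ENNReal.ofReal_ne_top]
    simp only [energy_one, energy_zero]
    simpa only [ENNReal.ofReal_mul (sq_nonneg (Real.sin φ₀)),
      ENNReal.ofReal_mul (show 0 ≤ 3 * R by linarith)] using key
  · exact Set.uIoc_subset_uIcc.trans (Set.ordConnected_Ioo.uIcc_subset
      ⟨by linarith [Real.pi_pos], Real.pi_pos⟩ hφ)
  · intro φ _
    refine le_trans ?_ (two_mul_abs_mul_le (A := g (polarPt m s θ φ)) hR (gradSq_nonneg R g _)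
      (sq_fderiv_azimuth_le (by linarith : R ≠ 0) g m (s * Real.cos θ)
        (s * (Real.sin θ * Real.cos φ)) (s * (Real.sin θ * Real.sin φ))))
    refine (abs_weighted_deriv_le (Real.abs_sin_le_one φ) (Real.abs_cos_le_one φ)).trans ?_
    exact mul_le_of_le_one_left (by positivity) (Real.abs_sin_le_one φ)

lemma energy_le_polar {R : ℝ} (hR : 1 ≤ R) {g : Sp → ℝ} (hg : IsTest g) (m : Fin 3)
    (s φ : ℝ) {θ₀ : ℝ} (hθ : θ₀ ∈ Set.Ioo 0 Real.pi) :
    ENNReal.ofReal (Real.sin θ₀ ^ 2) * energy R 0 g (polarPt m s θ₀ φ) ≤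
      ENNReal.ofReal (3 * R) * ∫⁻ θ in Set.Ioo 0 Real.pi,
        ENNReal.ofReal (Real.sin θ) * energy R 1 g (polarPt m s θ φ) := by
  have hc1 : Continuous fun θ => polarPt m s θ φ :=
    (continuous_polarPt m).comp (f := fun θ : ℝ => (s, θ, φ)) (by fun_prop)
  have hc2 : Continuous fun θ => shiftPt m (-(s * Real.sin θ)) (s * (Real.cos θ * Real.cos φ))
        (s * (Real.cos θ * Real.sin φ)) :=
    (continuous_shiftPt m).comp (f := fun θ : ℝ => (-(s * Real.sin θ),
      s * (Real.cos θ * Real.cos φ), s * (Real.cos θ * Real.sin φ))) (by fun_prop)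
  have hfd : Continuous (fderiv ℝ g) := hg.1.continuous_fderiv (by simp)
  have hgc : Continuous g := hg.1.continuous
  have hd := fun θ => (hg.differentiable _).hasFDerivAt.comp_hasDerivAt θ
    (hasDerivAt_polarPt_polar m s θ φ)
  have key := ofReal_le_setLIntegral (F := fun θ => Real.sin θ ^ 2 * (g (polarPt m s θ φ)) ^ 2)
    (G := fun θ => |Real.sin θ| *
      (3 * R * ((g (polarPt m s θ φ)) ^ 2 + gradSq R g (polarPt m s θ φ))))
    (fun θ => ((Real.hasDerivAt_sin θ).pow 2).mul ((hd θ).pow 2))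
    (by simp only [Function.comp_def]; fun_prop) (a := 0) (b := θ₀)
    (S := Set.Ioo 0 Real.pi) (by simp) measurableSet_Ioo ?_ ?_
  · rw [← lintegral_const_mul' _ _ ENNReal.ofReal_ne_top]
    rw [ENNReal.ofReal_mul (sq_nonneg (Real.sin θ₀))] at key
    refine key.trans (setLIntegral_mono' measurableSet_Ioo fun θ hθ' => ?_)
    rw [energy_one, abs_of_nonneg (Real.sin_nonneg_of_mem_Icc (Set.Ioo_subset_Icc_self hθ')),
      mul_left_comm, ENNReal.ofReal_mul (show 0 ≤ 3 * R by linarith),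
      ENNReal.ofReal_mul (Real.sin_nonneg_of_mem_Icc (Set.Ioo_subset_Icc_self hθ'))]
  · rw [Set.uIoc_of_le hθ.1.le]
    exact fun τ hτ => ⟨hτ.1, hτ.2.trans_lt hθ.2⟩
  · intro θ _
    have h := sq_fderiv_polar_le (by linarith : R ≠ 0) g m (s * Real.cos θ) (s * Real.sin θ) φ
    simp only [mul_assoc s] at h
    refine (abs_weighted_deriv_le (Real.abs_sin_le_one θ) (Real.abs_cos_le_one θ)).trans ?_
    exact mul_le_mul_of_nonneg_left
      (two_mul_abs_mul_le (A := g (polarPt m s θ φ)) hR (gradSq_nonneg R g _) h) (abs_nonneg _)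

lemma sum_sq_shiftPt (m : Fin 3) (u v w : ℝ) :
    (shiftPt m u v w 0) ^ 2 + (shiftPt m u v w 1) ^ 2 + (shiftPt m u v w 2) ^ 2 =
      u ^ 2 + v ^ 2 + w ^ 2 := by
  fin_cases m <;> simp [shiftPt] <;> ring

lemma sum_sq_polarPt (m : Fin 3) (s θ φ : ℝ) :
    (polarPt m s θ φ 0) ^ 2 + (polarPt m s θ φ 1) ^ 2 + (polarPt m s θ φ 2) ^ 2 = s ^ 2 := by
  rw [polarPt, sum_sq_shiftPt]
  linear_combination s ^ 2 * Real.sin_sq_add_cos_sq θ +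
    s ^ 2 * Real.sin θ ^ 2 * Real.sin_sq_add_cos_sq φ

lemma energy_le_radial (R : ℝ) {g : Sp → ℝ} (hg : IsTest g) (m : Fin 3)
    {s₀ : ℝ} (hs : 0 < s₀) (θ φ : ℝ) :
    ENNReal.ofReal (s₀ ^ 2) * energy R 0 g (polarPt m s₀ θ φ) ≤
      ∫⁻ s in Set.Ioi 0, ENNReal.ofReal (s ^ 2) * energy R 1 g (polarPt m s θ φ) := by
  obtain ⟨M, hM⟩ := hg.exists_bound
  have hc1 : Continuous fun s => polarPt m s θ φ :=
    (continuous_polarPt m).comp (f := fun s : ℝ => (s, θ, φ)) (by fun_prop)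
  have hfd : Continuous (fderiv ℝ g) := hg.1.continuous_fderiv (by simp)
  have hgc : Continuous g := hg.1.continuous
  have hd := fun s => (hg.differentiable _).hasFDerivAt.comp_hasDerivAt s
    (hasDerivAt_polarPt_radial m s θ φ)
  set a := s₀ + 2 * |M| + 1 with ha
  have key := ofReal_le_setLIntegral (F := fun s => s₀ ^ 2 * (g (polarPt m s θ φ)) ^ 2)
    (G := fun s => s ^ 2 * ((g (polarPt m s θ φ)) ^ 2 + gradSq R g (polarPt m s θ φ)))
    (fun s => ((hd s).pow 2).const_mul (s₀ ^ 2))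
    (by simp only [Function.comp_def]; fun_prop) (a := a) (b := s₀)
    (S := Set.Ioi s₀) ?_ measurableSet_Ioi ?_ ?_
  · rw [ENNReal.ofReal_mul (sq_nonneg s₀)] at key
    simp only [energy_one, energy_zero]
    simp only [ENNReal.ofReal_mul (sq_nonneg _)] at key
    exact key.trans (lintegral_mono_set (Set.Ioi_subset_Ioi hs.le))
  · have h : M < ‖polarPt m a θ φ‖ := by
      by_contra h
      rw [not_lt] at h
      have h1 : ∀ i, (polarPt m a θ φ i) ^ 2 ≤ |M| ^ 2 := fun i => by
        rw [sq_le_sq, abs_abs]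
        exact (norm_le_pi_norm (polarPt m a θ φ) i).trans (h.trans (le_abs_self M))
      have h2 := sum_sq_polarPt m a θ φ
      nlinarith [h1 0, h1 1, h1 2, abs_nonneg M]
    simp [hM _ h]
  · rw [Set.uIoc_of_ge (by rw [ha]; linarith [abs_nonneg M])]
    exact Set.Ioc_subset_Ioi_self
  · intro s hs'
    have h := sq_fderiv_unit_le R g (polarPt m s θ φ) (polarPt m 1 θ φ)
      (by rw [sum_sq_polarPt]; norm_num)
    change |_ * (_ * (g (polarPt m s θ φ)) ^ (2 - 1) * _)| ≤ _
    set A := g (polarPt m s θ φ)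
    set B := fderiv ℝ g (polarPt m s θ φ) (polarPt m 1 θ φ)
    rw [abs_mul, abs_of_nonneg (sq_nonneg s₀)]
    refine mul_le_mul (pow_le_pow_left₀ hs.le hs'.le 2) ?_ (abs_nonneg _) (sq_nonneg s)
    rw [abs_le]
    norm_num only [Nat.cast_ofNat, pow_one]
    constructor <;> nlinarith [sq_nonneg (A + B), sq_nonneg (A - B)]

lemma measurePreserving_shiftPt (m : Fin 3) :
    MeasurePreserving (fun p : ℝ × ℝ × ℝ => shiftPt m p.1 p.2.1 p.2.2) volume volume := by
  have h1 := (volume_preserving_finTwoArrow ℝ).symm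
  have h2 := (MeasurePreserving.id (volume : Measure ℝ)).prod h1
  have h3 := (volume_preserving_piFinSuccAbove (fun _ : Fin 3 => ℝ) 0).symm
  have h4 := volume_measurePreserving_piCongrLeft (fun _ : Fin 3 => ℝ) (Equiv.addRight m)
  suffices e : (fun p : ℝ × ℝ × ℝ => shiftPt m p.1 p.2.1 p.2.2) =
      ((MeasurableEquiv.piCongrLeft (fun _ : Fin 3 => ℝ) (Equiv.addRight m)) ∘
        (MeasurableEquiv.piFinSuccAbove (fun _ : Fin 3 => ℝ) 0).symm) ∘
        Prod.map id MeasurableEquiv.finTwoArrow.symm by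
    rw [e]
    exact (h4.comp h3).comp h2
  funext p i
  have : shiftPt m p.1 p.2.1 p.2.2 i = ![p.1, p.2.1, p.2.2] (i - m) := rfl
  rw [this]
  obtain ⟨j, rfl⟩ := (Equiv.addRight m).surjective i
  rw [Function.comp_apply, Function.comp_apply]
  erw [MeasurableEquiv.coe_piCongrLeft, Equiv.piCongrLeft_apply_apply]
  rw [Equiv.coe_addRight, add_sub_cancel_right]
  fin_cases j <;> rfl

lemma lintegral_shiftPt (m : Fin 3) {F : Sp → ENNReal} (hF : Measurable F) :
    ∫⁻ x, F x = ∫⁻ u, ∫⁻ p : ℝ × ℝ, F (shiftPt m u p.1 p.2) := by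
  rw [← (measurePreserving_shiftPt m).lintegral_comp hF, Measure.volume_eq_prod,
    lintegral_prod (fun p : ℝ × ℝ × ℝ => F (shiftPt m p.1 p.2.1 p.2.2))
      (hF.comp (continuous_shiftPt m).measurable).aemeasurable]

lemma lintegral_polar {H : ℝ × ℝ → ENNReal} (hH : Measurable H) :
    ∫⁻ p, H p = ∫⁻ φ in Set.Ioo (-Real.pi) Real.pi, ∫⁻ ρ in Set.Ioi 0,
      ENNReal.ofReal ρ * H (ρ * Real.cos φ, ρ * Real.sin φ) := by
  rw [← lintegral_comp_polarCoord_symm, polarCoord_target, Measure.volume_eq_prod,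
    ← Measure.prod_restrict, lintegral_prod_symm]
  · rfl
  · simp only [polarCoord_symm_apply, smul_eq_mul]
    fun_prop

lemma lintegral_polar_upper_le {H : ℝ × ℝ → ENNReal} (hH : Measurable H) :
    ∫⁻ θ in Set.Ioo 0 Real.pi, ∫⁻ s in Set.Ioi 0,
      ENNReal.ofReal s * H (s * Real.cos θ, s * Real.sin θ) ≤
        ∫⁻ u, ∫⁻ ρ in Set.Ioi 0, H (u, ρ) := by
  set K : ℝ × ℝ → ENNReal := (Set.univ ×ˢ Set.Ioi 0).indicator H with hK
  have hKm : Measurable K := hH.indicator (MeasurableSet.univ.prod measurableSet_Ioi)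
  have e : ∫⁻ u, ∫⁻ ρ in Set.Ioi 0, H (u, ρ) = ∫⁻ p, K p := by
    rw [Measure.volume_eq_prod, lintegral_prod _ hKm.aemeasurable]
    refine lintegral_congr fun u => ?_
    rw [← lintegral_indicator measurableSet_Ioi]
    refine lintegral_congr fun ρ => ?_
    by_cases h : 0 < ρ <;> simp [hK, h]
  rw [e, lintegral_polar hKm]
  refine le_trans ?_ (lintegral_mono_set (Set.Ioo_subset_Ioo_left (neg_nonpos.2 Real.pi_pos.le)))
  refine setLIntegral_mono' measurableSet_Ioo fun θ hθ => ?_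
  refine setLIntegral_mono' measurableSet_Ioi fun s hs => ?_
  have : (s * Real.cos θ, s * Real.sin θ) ∈ (Set.univ ×ˢ Set.Ioi (0 : ℝ) : Set (ℝ × ℝ)) :=
    ⟨trivial, mul_pos hs (Real.sin_pos_of_mem_Ioo hθ)⟩
  rw [hK, Set.indicator_of_mem this]

lemma lintegral_polarPt_le (m : Fin 3) {F : Sp → ENNReal} (hF : Measurable F) :
    ∫⁻ φ in Set.Ioo (-Real.pi) Real.pi, ∫⁻ θ in Set.Ioo 0 Real.pi, ENNReal.ofReal (Real.sin θ) *
      ∫⁻ s in Set.Ioi 0, ENNReal.ofReal (s ^ 2) * F (polarPt m s θ φ) ≤ ∫⁻ x, F x := by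
  have hm : Measurable fun p : ℝ × ℝ × ℝ => F (shiftPt m p.1 p.2.1 p.2.2) :=
    hF.comp (continuous_shiftPt m).measurable
  set K : ℝ → ℝ × ℝ → ENNReal := fun φ p => ENNReal.ofReal p.2 *
    F (shiftPt m p.1 (p.2 * Real.cos φ) (p.2 * Real.sin φ)) with hK
  have hKm : Measurable fun q : ℝ × ℝ × ℝ => K q.1 q.2 :=
    Measurable.mul (by fun_prop) (hm.comp (g := fun p : ℝ × ℝ × ℝ => F (shiftPt m p.1 p.2.1 p.2.2))
      (f := fun q : ℝ × ℝ × ℝ => (q.2.1, q.2.2 * Real.cos q.1, q.2.2 * Real.sin q.1))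
      (by fun_prop))
  calc _ = ∫⁻ φ in Set.Ioo (-Real.pi) Real.pi, ∫⁻ θ in Set.Ioo 0 Real.pi, ∫⁻ s in Set.Ioi 0,
        ENNReal.ofReal s * K φ (s * Real.cos θ, s * Real.sin θ) := by
        refine lintegral_congr fun φ => lintegral_congr fun θ => ?_
        rw [← lintegral_const_mul' _ _ ENNReal.ofReal_ne_top]
        refine setLIntegral_congr_fun measurableSet_Ioi fun s hs => ?_
        simp only [hK, polarPt, mul_assoc s]
        rw [← mul_assoc, ← mul_assoc, mul_comm (ENNReal.ofReal (Real.sin θ)),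
          ENNReal.ofReal_mul (le_of_lt hs), ← mul_assoc, pow_two, ENNReal.ofReal_mul (le_of_lt hs)]
        ring
    _ ≤ ∫⁻ φ in Set.Ioo (-Real.pi) Real.pi, ∫⁻ u, ∫⁻ ρ in Set.Ioi 0, K φ (u, ρ) :=
        lintegral_mono fun φ => lintegral_polar_upper_le (by fun_prop)
    _ = ∫⁻ u, ∫⁻ φ in Set.Ioo (-Real.pi) Real.pi, ∫⁻ ρ in Set.Ioi 0, K φ (u, ρ) := by
        refine lintegral_lintegral_swap (Measurable.aemeasurable ?_)
        refine Measurable.lintegral_prod_right'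
          (f := fun (q : (ℝ × ℝ) × ℝ) => K q.1.1 (q.1.2, q.2)) ?_
        exact hKm.comp (f := fun (q : (ℝ × ℝ) × ℝ) => (q.1.1, q.1.2, q.2)) (by fun_prop)
    _ = _ := by
        rw [lintegral_shiftPt m hF]
        refine lintegral_congr fun u => ?_
        rw [lintegral_polar (H := fun p => F (shiftPt m u p.1 p.2))
          (hm.comp (by fun_prop : Measurable fun p : ℝ × ℝ => (u, p)))]

lemma energy_zero_le_lintegral (R : ℝ) {g : Sp → ℝ} (hg : IsTest g) (x : Sp) :
    energy R 0 g x ≤ ∫⁻ y, energy R 3 g y := by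
  have step : ∀ (n : ℕ) (x : Sp) (i : Fin 3),
      energy R n g x ≤ ∫⁻ τ, energy R (n + 1) g (Function.update x i τ) := fun n x i => by
    have := mul_energy_le (R := R) (x₀ := x) (γ := fun τ => Function.update x i τ)
      (continuous_const.update i continuous_id) (S := Set.univ) (w := 1) (c := 1) (p := 1)
      measurable_const (fun h hh => by simpa using energy_le_line R hh x i) n hg
    simpa using this
  have hm : Measurable (energy R 3 g) := (hg.continuous_energy R 3).measurable
  rw [lintegral_shiftPt 0 hm]
  refine (step 0 x 0).trans (lintegral_mono fun a => ?_)
  rw [Measure.volume_eq_prod, lintegral_prod (fun p : ℝ × ℝ => energy R 3 g (shiftPt 0 a p.1 p.2))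
    (hm.comp ((continuous_shiftPt 0).comp (by fun_prop :
      Continuous fun p : ℝ × ℝ => (a, p))).measurable).aemeasurable]
  refine (step 1 _ 1).trans (lintegral_mono fun b => ?_)
  refine (step 2 _ 2).trans_eq (lintegral_congr fun c => ?_)
  congr 1
  ext i
  fin_cases i <;> simp [shiftPt]

lemma mul_energy_polarPt_le {R : ℝ} (hR : 1 ≤ R) {g : Sp → ℝ} (hg : IsTest g) (m : Fin 3)
    {s₀ θ₀ φ₀ : ℝ} (hs : 0 < s₀) (hθ : θ₀ ∈ Set.Ioo 0 Real.pi)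
    (hφ : φ₀ ∈ Set.Ioo (-Real.pi) Real.pi) :
    ENNReal.ofReal (s₀ ^ 2) * (ENNReal.ofReal (Real.sin θ₀ ^ 2) *
      (ENNReal.ofReal (Real.sin φ₀ ^ 2) * energy R 0 g (polarPt m s₀ θ₀ φ₀))) ≤
      ENNReal.ofReal (3 * R) * (ENNReal.ofReal (3 * R) * ∫⁻ x, energy R 3 g x) := by
  have h1 := energy_le_azimuth hR hg m s₀ θ₀ hφ
  have h2 := fun φ => mul_energy_le (R := R) (γ := fun θ => polarPt m s₀ θ φ)
    ((continuous_polarPt m).comp (f := fun θ : ℝ => (s₀, θ, φ)) (by fun_prop))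
    (p := fun θ => ENNReal.ofReal (Real.sin θ)) (by fun_prop)
    (fun h hh => energy_le_polar hR hh m s₀ φ hθ) 1 hg
  have h3 := fun θ φ => mul_energy_le (R := R) (γ := fun s => polarPt m s θ φ) (c := 1)
    ((continuous_polarPt m).comp (f := fun s : ℝ => (s, θ, φ)) (by fun_prop))
    (p := fun s => ENNReal.ofReal (s ^ 2)) (by fun_prop)
    (fun h hh => by simpa using energy_le_radial R hh m hs θ φ) 2 hg
  simp only [one_mul] at h3
  set c := ENNReal.ofReal (3 * R)
  set a := ENNReal.ofReal (s₀ ^ 2)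
  set b := ENNReal.ofReal (Real.sin θ₀ ^ 2)
  have hc : c ≠ ⊤ := ENNReal.ofReal_ne_top
  have ha : a ≠ ⊤ := ENNReal.ofReal_ne_top
  have hb : b ≠ ⊤ := ENNReal.ofReal_ne_top
  calc _ ≤ a * (b * (c * ∫⁻ φ in Set.Ioo (-Real.pi) Real.pi,
        energy R 1 g (polarPt m s₀ θ₀ φ))) := by gcongr
    _ = c * (a * ∫⁻ φ in Set.Ioo (-Real.pi) Real.pi, b * energy R 1 g (polarPt m s₀ θ₀ φ)) := by
        rw [lintegral_const_mul' _ _ hb]; ring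
    _ ≤ c * (a * ∫⁻ φ in Set.Ioo (-Real.pi) Real.pi, c * ∫⁻ θ in Set.Ioo 0 Real.pi,
        ENNReal.ofReal (Real.sin θ) * energy R 2 g (polarPt m s₀ θ φ)) := by
        exact mul_le_mul' le_rfl (mul_le_mul' le_rfl (lintegral_mono fun φ => h2 φ))
    _ = c * (c * ∫⁻ φ in Set.Ioo (-Real.pi) Real.pi, ∫⁻ θ in Set.Ioo 0 Real.pi,
        ENNReal.ofReal (Real.sin θ) * (a * energy R 2 g (polarPt m s₀ θ φ))) := by
        simp only [mul_left_comm _ a]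
        rw [lintegral_const_mul' _ _ hc]
        simp only [lintegral_const_mul' _ _ ha]
        ring
    _ ≤ c * (c * ∫⁻ φ in Set.Ioo (-Real.pi) Real.pi, ∫⁻ θ in Set.Ioo 0 Real.pi,
        ENNReal.ofReal (Real.sin θ) * ∫⁻ s in Set.Ioi 0,
          ENNReal.ofReal (s ^ 2) * energy R 3 g (polarPt m s θ φ)) := by
        gcongr with φ θ
        exact h3 θ φ
    _ ≤ _ := by
        gcongr
        exact lintegral_polarPt_le m (hg.continuous_energy R 3).measurable

lemma exists_polarPt (x : Sp) (m : Fin 3) (h : x (m + 2) ≠ 0) :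
    ∃ s θ φ, 0 < s ∧ θ ∈ Set.Ioo 0 Real.pi ∧ φ ∈ Set.Ioo (-Real.pi) Real.pi ∧
      x = polarPt m s θ φ ∧ x (m + 2) = s * (Real.sin θ * Real.sin φ) := by
  obtain ⟨ρ, φ, hρ, hφ, hv, hw⟩ : ∃ ρ φ : ℝ, 0 < ρ ∧ φ ∈ Set.Ioo (-Real.pi) Real.pi ∧
      x (m + 1) = ρ * Real.cos φ ∧ x (m + 2) = ρ * Real.sin φ := by
    have hs : (x (m + 1), x (m + 2)) ∈ polarCoord.source := Or.inr h
    have ht := polarCoord.map_source hs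
    have hl := polarCoord.left_inv hs
    rw [polarCoord_symm_apply] at hl
    exact ⟨_, _, ht.1, ht.2, (Prod.ext_iff.1 hl).1.symm, (Prod.ext_iff.1 hl).2.symm⟩
  obtain ⟨s, θ, hs, hθ, hu, hr⟩ : ∃ s θ : ℝ, 0 < s ∧ θ ∈ Set.Ioo (-Real.pi) Real.pi ∧
      x m = s * Real.cos θ ∧ ρ = s * Real.sin θ := by
    have hs : (x m, ρ) ∈ polarCoord.source := Or.inr hρ.ne'
    have ht := polarCoord.map_source hs
    have hl := polarCoord.left_inv hs
    rw [polarCoord_symm_apply] at hl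
    exact ⟨_, _, ht.1, ht.2, (Prod.ext_iff.1 hl).1.symm, (Prod.ext_iff.1 hl).2.symm⟩
  have hsin : 0 < Real.sin θ := pos_of_mul_pos_right (hr ▸ hρ) hs.le
  refine ⟨s, θ, φ, hs, ⟨?_, hθ.2⟩, hφ, ?_, by rw [hw, hr, mul_assoc]⟩
  · by_contra h0
    exact absurd (Real.sin_nonpos_of_nonpos_of_neg_pi_le (not_lt.1 h0) hθ.1.le) (not_le.2 hsin)
  · rw [hr, mul_assoc] at hv hw
    ext i
    obtain ⟨j, rfl⟩ := (Equiv.addLeft m).surjective i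
    rw [polarPt, ← hu, ← hv, ← hw, shiftPt, Equiv.coe_addLeft, add_sub_cancel_left]
    fin_cases j <;> simp

lemma svIter_append (l l' : List (Sp → Sp)) (g : Sp → ℝ) :
    svIter (l ++ l') g = svIter l (svIter l' g) := by
  induction l with
  | nil => rfl
  | cons X l ih => simp [svIter, ih]

lemma optApp_eq_svIter (R : ℝ) (o : Option (Fin 6)) (g : Sp → ℝ) :
    optApp R o g = svIter (o.toList.map (spatialField R)) g := by
  cases o <;> rfl

lemma IsTest.svIter {g : Sp → ℝ} (hg : IsTest g) (R : ℝ) (l : List (Fin 6)) :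
    IsTest (svIter (l.map (spatialField R)) g) := by
  induction l with
  | nil => exact hg
  | cons v l ih => exact ih.optApp R (some v)

lemma lintegral_energy_le {R : ℝ} (n : ℕ) {g : Sp → ℝ} (hg : IsTest g) {B : ENNReal}
    (h : ∀ l : List (Fin 6), l.length ≤ n →
      ∫⁻ x, ENNReal.ofReal ((svIter (l.map (spatialField R)) g x) ^ 2) ≤ B) :
    ∫⁻ x, energy R n g x ≤ 7 ^ n * B := by
  induction n generalizing g with
  | zero => simpa [svIter, energy] using h [] le_rfl
  | succ n ih =>
    have e : ∫⁻ x, energy R (n + 1) g x = ∑ o, ∫⁻ x, energy R n (optApp R o g) x :=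
      lintegral_finsetSum _ fun o _ => ((hg.optApp R o).continuous_energy R n).measurable
    rw [e]
    calc _ ≤ ∑ _o : Option (Fin 6), 7 ^ n * B := Finset.sum_le_sum fun o _ => by
          refine ih (hg.optApp R o) fun l hl => ?_
          rw [optApp_eq_svIter, ← svIter_append, ← List.map_append]
          refine h _ ?_
          rw [List.length_append]
          cases o <;> simp <;> omega
      _ = _ := by
          rw [Finset.sum_const, Finset.card_univ, Fintype.card_option, Fintype.card_fin,
            nsmul_eq_mul]
          push_cast
          ring

/-- The position in `KRfields R o3` of the field corresponding to `spatialField R v`. -/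
def fieldIdx (R : ℝ) (v : Fin 6) : Fin (KRfields R o3).length :=
  ⟨v + 1, by simp [KRfields]; omega⟩

lemma get_fieldIdx (R : ℝ) (v : Fin 6) (p : Pt) :
    (KRfields R o3).get (fieldIdx R v) p = stp 0 (spatialField R v fun i => p i.succ) := by
  ext j
  fin_cases v <;> fin_cases j <;>
    simp [KRfields, fieldIdx, stp, spatialField, transVF, smulVF, rotVF, sidx, o3] <;> rfl

lemma hasFDerivAt_stp (t : ℝ) (x : Sp) :
    ∃ L : Sp →L[ℝ] Pt, HasFDerivAt (stp t) L x ∧ ∀ y, L y = stp 0 y := by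
  refine ⟨ContinuousLinearMap.pi ![0, ContinuousLinearMap.proj 0, ContinuousLinearMap.proj 1,
    ContinuousLinearMap.proj 2], ?_, fun y => ?_⟩
  · rw [hasFDerivAt_pi]
    intro i
    fin_cases i
    · exact hasFDerivAt_const t x
    · exact hasFDerivAt_apply 0 x
    · exact hasFDerivAt_apply 1 x
    · exact hasFDerivAt_apply 2 x
  · ext i
    fin_cases i <;> simp [stp]

lemma contDiff_stp (t : ℝ) : ContDiff ℝ (⊤ : ℕ∞) (stp t) := by
  rw [contDiff_pi]
  intro i
  fin_cases i <;> simp [stp] <;> fun_prop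

lemma contDiff_vIter_fieldIdx {f : Pt → ℝ} (hf : ContDiff ℝ (⊤ : ℕ∞) f) (R : ℝ)
    (l : List (Fin 6)) :
    ContDiff ℝ (⊤ : ℕ∞) (vIter ((l.map (fieldIdx R)).map (KRfields R o3).get) f) := by
  induction l with
  | nil => exact hf
  | cons v l ih =>
    refine (ih.fderiv_right (m := (⊤ : ℕ∞)) (by simp)).clm_apply ?_
    have e : (KRfields R o3).get (fieldIdx R v) =
        fun p => stp 0 (spatialField R v fun i => p i.succ) := funext (get_fieldIdx R v)
    rw [e]
    exact (contDiff_stp 0).comp ((contDiff_spatialField R v).comp (by fun_prop))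

lemma vIter_stp {f : Pt → ℝ} (hf : ContDiff ℝ (⊤ : ℕ∞) f) (R t : ℝ) (l : List (Fin 6)) (x : Sp) :
    vIter ((l.map (fieldIdx R)).map (KRfields R o3).get) f (stp t x) =
      svIter (l.map (spatialField R)) (fun x => f (stp t x)) x := by
  induction l generalizing x with
  | nil => rfl
  | cons v l ih =>
    obtain ⟨L, hL, hLy⟩ := hasFDerivAt_stp t x
    have hd := ((contDiff_vIter_fieldIdx hf R l).differentiable (by simp) (stp t x)).hasFDerivAt
    have hc := hd.comp x hL
    have e : svIter (l.map (spatialField R)) (fun x => f (stp t x)) =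
      vIter ((l.map (fieldIdx R)).map (KRfields R o3).get) f ∘ stp t := funext fun x => (ih x).symm
    simp only [List.map_cons, vIter, svIter, vApp, svApp]
    rw [e, hc.fderiv, ContinuousLinearMap.comp_apply, hLy, get_fieldIdx]
    have hx : (fun i : Fin 3 => stp t x i.succ) = x := by ext i; fin_cases i <;> rfl
    rw [hx]

lemma slice2_sq_le_sum (R : ℝ) (f : Pt → ℝ) (t : ℝ) {n : ℕ}
    (l : List (Fin (KRfields R o3).length)) (hl : l.length < n) :
    (slice2 (vIter (l.map (KRfields R o3).get) f) t) ^ 2 ≤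
      ∑ k ∈ Finset.range n, ∑ I : Fin k → Fin (KRfields R o3).length,
        (slice2 (vIter ((List.ofFn I).map (KRfields R o3).get) f) t) ^ 2 := by
  refine le_trans ?_ (Finset.single_le_sum (fun k _ => Finset.sum_nonneg fun I _ => sq_nonneg _)
    (Finset.mem_range.2 hl))
  refine le_trans (le_of_eq ?_) (Finset.single_le_sum
    (f := fun I : Fin l.length → Fin (KRfields R o3).length =>
      (slice2 (vIter ((List.ofFn I).map (KRfields R o3).get) f) t) ^ 2)
    (fun I _ => sq_nonneg _) (Finset.mem_univ l.get))
  simp only [List.ofFn_get]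

lemma IsTest.lintegral_sq {h : Sp → ℝ} (hh : IsTest h) :
    ∫⁻ x, ENNReal.ofReal (h x ^ 2) = ENNReal.ofReal (∫ x, h x ^ 2) := by
  have hc : HasCompactSupport fun x => h x ^ 2 :=
    hh.2.mono fun x hx => by
      rw [Function.mem_support] at hx ⊢
      exact fun h0 => hx (by simp [h0])
  exact (ofReal_integral_eq_lintegral_ofReal
    ((hh.1.continuous.pow 2).integrable_of_hasCompactSupport hc)
    (Filter.Eventually.of_forall fun x => sq_nonneg _)).symm

lemma slice2_sq (f : Pt → ℝ) (t : ℝ) : (slice2 f t) ^ 2 = ∫ x, (f (stp t x)) ^ 2 :=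
  Real.sq_sqrt (integral_nonneg fun _ => sq_nonneg _)

lemma lintegral_energy_slice_le {f : Pt → ℝ} (hf : ContDiff ℝ (⊤ : ℕ∞) f) (R t : ℝ)
    (hg : IsTest fun x => f (stp t x)) (n : ℕ) :
    ∫⁻ x, energy R n (fun x => f (stp t x)) x ≤ 7 ^ n * ENNReal.ofReal
      (∑ k ∈ Finset.range (n + 1), ∑ I : Fin k → Fin (KRfields R o3).length,
        (slice2 (vIter ((List.ofFn I).map (KRfields R o3).get) f) t) ^ 2) := by
  refine lintegral_energy_le n hg fun l hl => ?_
  have hlen : (l.map (fieldIdx R)).length < n + 1 := by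
    rw [List.length_map]
    omega
  rw [(hg.svIter R l).lintegral_sq]
  refine ENNReal.ofReal_le_ofReal (le_trans (le_of_eq ?_)
    (slice2_sq_le_sum R f t (l.map (fieldIdx R)) hlen))
  rw [slice2_sq]
  simp only [vIter_stp hf]

lemma sq_coord_mul_energy_le {R : ℝ} (hR : 1 ≤ R) {g : Sp → ℝ} (hg : IsTest g) (x : Sp)
    (i : Fin 3) :
    ENNReal.ofReal ((x i * g x) ^ 2) ≤ ENNReal.ofReal (9 * R ^ 2) * ∫⁻ y, energy R 3 g y := by
  by_cases h : x i = 0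
  · simp [h]
  obtain ⟨m, rfl⟩ : ∃ m, m + 2 = i := ⟨i - 2, sub_add_cancel i 2⟩
  obtain ⟨s, θ, φ, hs, hθ, hφ, hx, hxi⟩ := exists_polarPt x m h
  have key := mul_energy_polarPt_le hR hg m hs hθ hφ
  rw [← hx, energy_zero, ← ENNReal.ofReal_mul (sq_nonneg _), ← ENNReal.ofReal_mul (sq_nonneg _),
    ← ENNReal.ofReal_mul (sq_nonneg _), ← mul_assoc (ENNReal.ofReal (3 * R)),
    ← ENNReal.ofReal_mul (by linarith)] at key
  convert key using 3
  · rw [hxi]; ring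
  · ring

/-- Lemma 6.3, `R`-weighted Klainkerman–Sobolev inequality:
`|f|² ≤ C R²/(1+r)² Σ_{|I| ≤ 3} ‖V^I f‖²_{L²(Σ_t)}` with fields from `K_R`. -/
theorem weighted_sobolev_KR :
    ∃ C > (0 : ℝ), ∀ R : ℝ, 1 ≤ R → ∀ f : Pt → ℝ,
      ContDiff ℝ (⊤ : ℕ∞) f →
      (∀ t : ℝ, HasCompactSupport fun x : Sp => f (stp t x)) →
      ∀ t : ℝ, ∀ x : Sp,
        (f (stp t x)) ^ 2 ≤
          C * R ^ 2 / (1 + rad3 x) ^ 2 *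
            ∑ k ∈ Finset.range 4, ∑ I : Fin k → Fin (KRfields R o3).length,
              (slice2 (vIter ((List.ofFn I).map (KRfields R o3).get) f) t) ^ 2 := by
  refine ⟨56 * 343, by norm_num, fun R hR f hf hsupp t x => ?_⟩
  have hg : IsTest fun x => f (stp t x) := ⟨hf.comp (contDiff_stp t), hsupp t⟩
  have hE := lintegral_energy_slice_le hf R t hg 3
  set S := ∑ k ∈ Finset.range (3 + 1), ∑ I : Fin k → Fin (KRfields R o3).length,
    (slice2 (vIter ((List.ofFn I).map (KRfields R o3).get) f) t) ^ 2 with hS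
  have hS0 : 0 ≤ S := Finset.sum_nonneg fun k _ => Finset.sum_nonneg fun I _ => sq_nonneg _
  have h343 : (7 : ENNReal) ^ 3 * ENNReal.ofReal S = ENNReal.ofReal (343 * S) := by
    rw [ENNReal.ofReal_mul (by norm_num)]
    norm_num
  rw [h343] at hE
  set y := f (stp t x) with hy
  have h0 : y ^ 2 ≤ 343 * S :=
    (ENNReal.ofReal_le_ofReal_iff (by positivity)).1 ((energy_zero_le_lintegral R hg x).trans hE)
  have hi : ∀ i, (x i * y) ^ 2 ≤ 9 * R ^ 2 * (343 * S) := fun i => by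
    rw [← ENNReal.ofReal_le_ofReal_iff (by positivity), ENNReal.ofReal_mul (by positivity)]
    exact (sq_coord_mul_energy_le hR hg x i).trans (mul_le_mul' le_rfl hE)
  have hr : (rad3 x) ^ 2 = (x 0) ^ 2 + (x 1) ^ 2 + (x 2) ^ 2 := Real.sq_sqrt (by positivity)
  have hr0 : 0 ≤ rad3 x := Real.sqrt_nonneg _
  have hR2 : 1 ≤ R ^ 2 := one_le_pow₀ hR
  rw [div_mul_eq_mul_div, le_div_iff₀ (by positivity)]
  have h1 : y ^ 2 * (1 + rad3 x) ^ 2 ≤ y ^ 2 * (2 * (1 + (rad3 x) ^ 2)) :=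
    mul_le_mul_of_nonneg_left (by nlinarith [sq_nonneg (1 - rad3 x)]) (sq_nonneg y)
  have h2 : 343 * S ≤ R ^ 2 * (343 * S) := le_mul_of_one_le_left (by positivity) hR2
  rw [hr] at h1
  nlinarith [hi 0, hi 1, hi 2]

end
end
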